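/- Let G be a skeletal claw-free graph admitting a gear 2-join ((X1,Y1),(X2,Y2)), and let l be an integer with l ≥ γ_ℓ^j(H2). If G1 = G[V1] has a proper l-colouring, then G has a proper l-colouring. -/

import Mathlib

open SimpleGraph

namespace Paper

variable {V : Type*} {W : Type*}

/-- A graph is claw-free if no vertex has three pairwise nonadjacent neighbours. -/
def ClawFree (G : SimpleGraph V) : Prop :=
  ¬ ∃ (v a b c : V), G.Adj v a ∧ G.Adj v b ∧ G.Adj v c ∧
      ¬G.Adj a b ∧ ¬G.Adj a c ∧ ¬G.Adj b c ∧ a ≠ b ∧ a ≠ c ∧ b ≠ c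

/-- A graph is quasi-line if every neighbourhood is covered by two cliques. -/
def QuasiLine (G : SimpleGraph V) : Prop :=
  ∀ v : V, ∃ S T : Set V, G.IsClique S ∧ G.IsClique T ∧ G.neighborSet v ⊆ S ∪ T

/-- The clique number ω(G). -/
noncomputable def cliqueNum (G : SimpleGraph V) : ℕ :=
  sSup {n | ∃ s : Finset V, G.IsNClique n s}

/-- The clique number of the subgraph induced on a vertex set `S`. -/
noncomputable def cliqueNumOn (G : SimpleGraph V) (S : Set V) : ℕ :=
  sSup {n | ∃ s : Finset V, ↑s ⊆ S ∧ G.IsNClique n s}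

/-- ω(v): the maximum size of a clique containing `v`. -/
noncomputable def omegaAt (G : SimpleGraph V) (v : V) : ℕ :=
  sSup {n | ∃ s : Finset V, G.IsNClique n s ∧ v ∈ s}

/-- The degree of a vertex (as the cardinality of its neighbourhood). -/
noncomputable def degree' (G : SimpleGraph V) (v : V) : ℕ := (G.neighborSet v).ncard

/-- The maximum degree Δ(G). -/
noncomputable def maxDeg (G : SimpleGraph V) : ℕ := sSup {n | ∃ v : V, n = degree' G v}

/-- γ_ℓ(v) = ⌈(d(v)+1+ω(v))/2⌉. -/
noncomputable def gammaLocalAt (G : SimpleGraph V) (v : V) : ℕ :=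
  (degree' G v + 1 + omegaAt G v + 1) / 2

/-- γ_ℓ(G) = max over vertices of γ_ℓ(v). -/
noncomputable def gammaLocal (G : SimpleGraph V) : ℕ :=
  sSup {n | ∃ v : V, n = gammaLocalAt G v}

/-- The closed neighbourhood of a vertex. -/
def closedNbhd (G : SimpleGraph V) (v : V) : Set V := insert v (G.neighborSet v)

/-- The closed neighbourhood within an induced subgraph on `S`. -/
def closedNbhdOn (G : SimpleGraph V) (S : Set V) (v : V) : Set V := S ∩ closedNbhd G v

/-- A triad: three pairwise nonadjacent vertices. -/
def IsTriad (G : SimpleGraph V) (T : Finset V) : Prop :=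
  T.card = 3 ∧ ∀ u ∈ T, ∀ w ∈ T, u ≠ w → ¬G.Adj u w

/-- A good triad within the induced subgraph on `S`: every vertex of the induced subgraph
outside `T` has two neighbours in `T`, or a twin in `T`, or is trumped by a vertex of `T`. -/
def GoodTriadOn (G : SimpleGraph V) (S : Set V) (T : Finset V) : Prop :=
  ↑T ⊆ S ∧ IsTriad G T ∧
    ∀ v ∈ S, v ∉ T →
      (∃ t1 ∈ T, ∃ t2 ∈ T, t1 ≠ t2 ∧ G.Adj v t1 ∧ G.Adj v t2) ∨
      (∃ t ∈ T, closedNbhdOn G S v = closedNbhdOn G S t) ∨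
      (∃ t ∈ T, closedNbhdOn G S v ⊂ closedNbhdOn G S t)

/-- A good triad in `G`. -/
def GoodTriad (G : SimpleGraph V) (T : Finset V) : Prop := GoodTriadOn G Set.univ T

/-- A homogeneous pair of cliques within the induced subgraph on `S`. -/
def IsHomPairOn (G : SimpleGraph V) (S : Set V) (A B : Finset V) : Prop :=
  ↑A ⊆ S ∧ ↑B ⊆ S ∧ G.IsClique (↑A : Set V) ∧ G.IsClique (↑B : Set V) ∧
    A.Nonempty ∧ B.Nonempty ∧ Disjoint A B ∧ 3 ≤ A.card + B.card ∧
    ∀ v ∈ S, v ∉ A → v ∉ B →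
      ((∀ a ∈ A, G.Adj v a) ∨ (∀ a ∈ A, ¬G.Adj v a)) ∧
      ((∀ b ∈ B, G.Adj v b) ∨ (∀ b ∈ B, ¬G.Adj v b))

/-- A homogeneous pair of cliques in `G`. -/
def IsHomPair (G : SimpleGraph V) (A B : Finset V) : Prop := IsHomPairOn G Set.univ A B

/-- A homogeneous pair of cliques `(A,B)` is skeletal if deleting any single edge
between `A` and `B` strictly decreases the clique number of `G[A ∪ B]`. -/
def IsSkeletalPair (G : SimpleGraph V) (A B : Finset V) : Prop :=
  ∀ a ∈ A, ∀ b ∈ B, G.Adj a b →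
    cliqueNumOn (G.deleteEdges {s(a, b)}) (↑A ∪ ↑B) < cliqueNumOn G (↑A ∪ ↑B)

/-- A graph is skeletal if every homogeneous pair of cliques in it is skeletal. -/
def Skeletal (G : SimpleGraph V) : Prop :=
  ∀ A B : Finset V, IsHomPair G A B → IsSkeletalPair G A B

/-- A linear pair: no induced C₄ between `A` and `B`. -/
def IsLinearPair (G : SimpleGraph V) (A B : Finset V) : Prop :=
  ¬ ∃ a1 ∈ A, ∃ a2 ∈ A, ∃ b1 ∈ B, ∃ b2 ∈ B,
      G.Adj a1 b1 ∧ G.Adj a2 b2 ∧ ¬G.Adj a1 b2 ∧ ¬G.Adj a2 b1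

/-- A homogeneous clique. -/
def IsHomogeneousClique [Fintype V] (G : SimpleGraph V) (C : Finset V) : Prop :=
  G.IsClique (↑C : Set V) ∧ 2 ≤ C.card ∧ C.card ≤ Fintype.card V - 1 ∧
    ∀ v ∉ C, (∀ c ∈ C, G.Adj v c) ∨ (∀ c ∈ C, ¬G.Adj v c)

/-- `X` straddles the three-cliquing `(A,B,C)` if it meets more than one of `A`, `B`, `C`. -/
def Straddles (A B C : Set V) (X : Finset V) : Prop :=
  ((↑X ∩ A).Nonempty ∧ (↑X ∩ B).Nonempty) ∨
  ((↑X ∩ A).Nonempty ∧ (↑X ∩ C).Nonempty) ∨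
  ((↑X ∩ B).Nonempty ∧ (↑X ∩ C).Nonempty)

/-- A three-cliqued graph is weakly skeletal if every nonskeletal homogeneous pair
of cliques is straddling. -/
def WeaklySkeletal (G : SimpleGraph V) (A B C : Set V) : Prop :=
  ∀ X Y : Finset V, IsHomPair G X Y → ¬IsSkeletalPair G X Y →
    Straddles A B C X ∨ Straddles A B C Y

/-- A set of unordered pairs forming a matching (pairwise disjoint non-loop pairs). -/
def IsMatchingSet (M : Set (Sym2 W)) : Prop :=
  (∀ e ∈ M, ¬e.IsDiag) ∧ ∀ e ∈ M, ∀ e' ∈ M, e ≠ e' → ∀ w : W, w ∈ e → w ∉ e'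

/-- `G[D]` is a thickening of `H[R]` under the matching `M`, via the fiber map `f`. -/
structure IsThickeningBetween (H : SimpleGraph W) (M : Set (Sym2 W)) (R : Set W)
    (G : SimpleGraph V) (D : Set V) (f : V → W) : Prop where
  maps_into : ∀ v ∈ D, f v ∈ R
  fibers_nonempty : ∀ w ∈ R, ∃ v ∈ D, f v = w
  fibers_clique : ∀ w : W, G.IsClique {v | v ∈ D ∧ f v = w}
  adj_of_adj : ∀ u ∈ D, ∀ v ∈ D, f u ≠ f v → H.Adj (f u) (f v) → s(f u, f v) ∉ M → G.Adj u v
  nonadj_of_nonadj : ∀ u ∈ D, ∀ v ∈ D, f u ≠ f v → ¬H.Adj (f u) (f v) → ¬G.Adj u v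
  semi_adj : ∀ x ∈ R, ∀ y ∈ R, s(x, y) ∈ M →
    ∃ u ∈ D, ∃ v ∈ D, f u = x ∧ f v = y ∧ G.Adj u v
  semi_nonadj : ∀ x ∈ R, ∀ y ∈ R, s(x, y) ∈ M →
    ∃ u ∈ D, ∃ v ∈ D, f u = x ∧ f v = y ∧ ¬G.Adj u v

/-- `G` is a thickening of `H[R]` under `M`. -/
def IsThickeningOn (H : SimpleGraph W) (M : Set (Sym2 W)) (R : Set W)
    (G : SimpleGraph V) (f : V → W) : Prop :=
  IsThickeningBetween H M R G Set.univ f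

/-- `G` is a thickening of `H` under `M`. -/
def IsThickening (H : SimpleGraph W) (M : Set (Sym2 W)) (G : SimpleGraph V) (f : V → W) : Prop :=
  IsThickeningBetween H M Set.univ G Set.univ f

/-- A graph is antiprismatic if every vertex outside a triad has exactly two
neighbours in it. -/
def Antiprismatic (H : SimpleGraph W) : Prop :=
  ∀ T : Finset W, IsTriad H T → ∀ v ∉ T,
    ∃ t ∈ T, ¬H.Adj v t ∧ ∀ t' ∈ T, t' ≠ t → H.Adj v t'

/-- A changeable matching in an antiprismatic graph. -/
def ChangeableMatching (H : SimpleGraph W) (M : Set (Sym2 W)) : Prop :=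
  M ⊆ H.edgeSet ∧ IsMatchingSet M ∧ ∀ M' ⊆ M, Antiprismatic (H.deleteEdges M')



/-- The icosahedron `G0` on vertices `v0, …, v11`. -/
def icoG0 : SimpleGraph (Fin 12) :=
  SimpleGraph.fromRel (fun i j =>
    (1 ≤ i.val ∧ i.val ≤ 10 ∧ (j.val = i.val % 10 + 1 ∨ j.val = (i.val + 1) % 10 + 1)) ∨
    (i.val = 0 ∧ j.val % 2 = 1 ∧ 1 ≤ j.val ∧ j.val ≤ 10) ∨
    (i.val = 11 ∧ j.val % 2 = 0 ∧ 1 ≤ j.val ∧ j.val ≤ 10))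

/-- `G1 = G0 − v11`. -/
def icoG1 : SimpleGraph (Fin 11) :=
  SimpleGraph.fromRel (fun i j =>
    (1 ≤ i.val ∧ (j.val = i.val % 10 + 1 ∨ j.val = (i.val + 1) % 10 + 1)) ∨
    (i.val = 0 ∧ j.val % 2 = 1))

/-- `G2 = G1 − v10`. -/
def icoG2 : SimpleGraph (Fin 10) :=
  SimpleGraph.fromRel (fun i j =>
    (1 ≤ i.val ∧ (j.val = i.val % 10 + 1 ∨ j.val = (i.val + 1) % 10 + 1)) ∨
    (i.val = 0 ∧ j.val % 2 = 1))

/-- An icosahedral thickening: a proper thickening of `G0` or `G1`, or a thickening of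
`G2 ∪ M` under a matching `M ⊆ {v1v4, v6v9}`. -/
def IsIcosahedralThickening (G : SimpleGraph V) : Prop :=
  (∃ f : V → Fin 12, IsThickening icoG0 ∅ G f) ∨
  (∃ f : V → Fin 11, IsThickening icoG1 ∅ G f) ∨
  (∃ (M : Set (Sym2 (Fin 10))) (f : V → Fin 10),
      M ⊆ {s((1 : Fin 10), 4), s(6, 9)} ∧
      IsThickening (icoG2 ⊔ SimpleGraph.fromEdgeSet M) M G f)

/-! ### Antihat graphs -/

/-- The vertex type of the antihat base graph: `A = {a0,…,ak}`, `B = {b0,…,bk}`,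
`C = {c1,…,ck}` (the third component `i` encodes `c_{i+1}`). -/
abbrev AHV (k : ℕ) : Type := Fin (k + 1) ⊕ Fin (k + 1) ⊕ Fin k

def ahA {k : ℕ} (i : Fin (k + 1)) : AHV k := Sum.inl i
def ahB {k : ℕ} (i : Fin (k + 1)) : AHV k := Sum.inr (Sum.inl i)
def ahC {k : ℕ} (i : Fin k) : AHV k := Sum.inr (Sum.inr i)

/-- The antihat base graph `H`, where `e00` records whether `a0` and `b0` are adjacent. -/
def antihatH (k : ℕ) (e00 : Bool) : SimpleGraph (AHV k) :=
  SimpleGraph.fromRel (fun x y =>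
    match x, y with
    | Sum.inl _, Sum.inl _ => True
    | Sum.inr (Sum.inl _), Sum.inr (Sum.inl _) => True
    | Sum.inr (Sum.inr _), Sum.inr (Sum.inr _) => True
    | Sum.inl i, Sum.inr (Sum.inl j) =>
        (i = j ∧ 1 ≤ i.val) ∨ (i.val = 0 ∧ j.val = 0 ∧ e00 = true)
    | Sum.inl i, Sum.inr (Sum.inr j) => 1 ≤ i.val ∧ i.val ≠ j.val + 1
    | Sum.inr (Sum.inl i), Sum.inr (Sum.inr j) => 1 ≤ i.val ∧ i.val ≠ j.val + 1
    | _, _ => False)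

/-- The conditions on the matching `M` of an antihat thickening with deleted set `Xd`. -/
def AntihatM (k : ℕ) (e00 : Bool) (Xd : Finset (AHV k)) (M : Set (Sym2 (AHV k))) : Prop :=
  IsMatchingSet M ∧
  (∀ e ∈ M, ∀ w : AHV k, w ∈ e → w ∉ Xd) ∧
  (∀ i j : Fin (k + 1), s(ahA i, ahA j) ∉ M) ∧
  (∀ i j : Fin (k + 1), s(ahB i, ahB j) ∉ M) ∧
  (∀ i j : Fin k, s(ahC i, ahC j) ∉ M) ∧
  (e00 = true → s(ahA (0 : Fin (k + 1)), ahB (0 : Fin (k + 1))) ∈ M) ∧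
  (∀ i j : Fin (k + 1), 1 ≤ i.val → 1 ≤ j.val → s(ahA i, ahB j) ∈ M →
      i = j ∧ ∃ c : Fin k, c.val + 1 = i.val ∧ ahC c ∈ Xd) ∧
  (∀ i : Fin (k + 1), ∀ j : Fin k, 1 ≤ i.val → s(ahB i, ahC j) ∈ M →
      i.val = j.val + 1 ∧ ahA i ∈ Xd) ∧
  (∀ i : Fin (k + 1), ∀ j : Fin k, 1 ≤ i.val → s(ahA i, ahC j) ∈ M →
      i.val = j.val + 1 ∧ ahB i ∈ Xd)

/-! ### Strips and generalized 2-joins -/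

/-- The induced subgraph on `S` contains an induced `W5` (a 5-wheel). -/
def HasInducedW5On (G : SimpleGraph V) (S : Set V) : Prop :=
  ∃ w c0 c1 c2 c3 c4 : V,
    w ∈ S ∧ c0 ∈ S ∧ c1 ∈ S ∧ c2 ∈ S ∧ c3 ∈ S ∧ c4 ∈ S ∧
    G.Adj w c0 ∧ G.Adj w c1 ∧ G.Adj w c2 ∧ G.Adj w c3 ∧ G.Adj w c4 ∧
    G.Adj c0 c1 ∧ G.Adj c1 c2 ∧ G.Adj c2 c3 ∧ G.Adj c3 c4 ∧ G.Adj c4 c0 ∧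
    c0 ≠ c2 ∧ c0 ≠ c3 ∧ c1 ≠ c3 ∧ c1 ≠ c4 ∧ c2 ≠ c4 ∧
    ¬G.Adj c0 c2 ∧ ¬G.Adj c0 c3 ∧ ¬G.Adj c1 c3 ∧ ¬G.Adj c1 c4 ∧ ¬G.Adj c2 c4

/-- A generalized 2-join `((X1,Y1),(X2,Y2))` of `G` separating `V1` from `V2`,
with `X1, X2, Y1, Y2` pairwise disjoint except possibly `X1` and `Y1`. -/
structure IsGen2Join [Fintype V] [DecidableEq V] (G : SimpleGraph V)
    (V1 V2 X1 Y1 X2 Y2 : Finset V) : Prop where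
  disjV : Disjoint V1 V2
  unionV : V1 ∪ V2 = Finset.univ
  subX1 : X1 ⊆ V1
  subY1 : Y1 ⊆ V1
  subX2 : X2 ⊆ V2
  subY2 : Y2 ⊆ V2
  cliqueX : G.IsClique (↑X1 ∪ ↑X2 : Set V)
  cliqueY : G.IsClique (↑Y1 ∪ ↑Y2 : Set V)
  cross : ∀ u ∈ V1, ∀ v ∈ V2, G.Adj u v → (u ∈ X1 ∧ v ∈ X2) ∨ (u ∈ Y1 ∧ v ∈ Y2)
  disjX2Y2 : Disjoint X2 Y2

/-- ω'(v): the maximum size of a clique of `H2 = G[V2 ∪ X1 ∪ Y1]` containing `v`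
and not intersecting both `X1 ∖ Y1` and `Y1 ∖ X1`. -/
noncomputable def omegaJ [DecidableEq V] (G : SimpleGraph V) (V2 X1 Y1 : Finset V) (v : V) : ℕ :=
  sSup {n | ∃ s : Finset V, G.IsNClique n s ∧ v ∈ s ∧ s ⊆ V2 ∪ X1 ∪ Y1 ∧
      ¬((∃ x ∈ s, x ∈ X1 ∧ x ∉ Y1) ∧ ∃ y ∈ s, y ∈ Y1 ∧ y ∉ X1)}

/-- γ_ℓ^j(H2) = max over `v ∈ V2 ∪ X1 ∪ Y1` of ⌈(d_G(v)+1+ω'(v))/2⌉. -/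
noncomputable def gammaLJ [DecidableEq V] (G : SimpleGraph V) (V2 X1 Y1 : Finset V) : ℕ :=
  (V2 ∪ X1 ∪ Y1).sup fun v => (degree' G v + 1 + omegaJ G V2 X1 Y1 v + 1) / 2

/-- `(G[V2], X2, Y2)` is an antihat strip. -/
def IsAntihatStripOn (G : SimpleGraph V) (V2 X2 Y2 : Finset V) : Prop :=
  ∃ (k : ℕ) (e00 : Bool) (Xd : Finset (AHV k)) (M : Set (Sym2 (AHV k))) (f : V → AHV k),
    2 ≤ k ∧ ahA (0 : Fin (k + 1)) ∉ Xd ∧ ahB (0 : Fin (k + 1)) ∉ Xd ∧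
    (∃ i j : Fin k, i ≠ j ∧ ahC i ∉ Xd ∧ ahC j ∉ Xd) ∧
    AntihatM k e00 Xd M ∧
    IsThickeningBetween (antihatH k e00 ⊔ SimpleGraph.fromEdgeSet M) M
      ((↑Xd ∪ {ahA (0 : Fin (k + 1)), ahB (0 : Fin (k + 1))} : Set (AHV k))ᶜ)
      G (↑V2 : Set V) f ∧
    (↑X2 : Set V) = {v | v ∈ V2 ∧ ∃ i : Fin (k + 1), 1 ≤ i.val ∧ f v = ahA i ∧ ahA i ∉ Xd} ∧
    (↑Y2 : Set V) = {v | v ∈ V2 ∧ ∃ i : Fin (k + 1), 1 ≤ i.val ∧ f v = ahB i ∧ ahB i ∉ Xd} ∧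
    HasInducedW5On G (↑V2 : Set V)

/-- The base graph of strange strips, on `a1=0, a2=1, b1=2, b2=3, b3=4, c1=5, c2=6`. -/
def strangeH : SimpleGraph (Fin 7) :=
  SimpleGraph.fromEdgeSet
    {s(0, 1), s(2, 3), s(2, 4), s(3, 4), s(5, 6),
     s(0, 2), s(1, 5), s(3, 5), s(4, 5), s(0, 6), s(1, 6), s(2, 6), s(3, 6)}

/-- The matching `{b3c1, b2c2}` of strange strips. -/
def strangeM : Set (Sym2 (Fin 7)) := {s(4, 5), s(3, 6)}

/-- `(G[V2], X2, Y2)` is a strange strip. -/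
def IsStrangeStripOn (G : SimpleGraph V) (V2 X2 Y2 : Finset V) : Prop :=
  ∃ f : V → Fin 7,
    IsThickeningBetween strangeH strangeM Set.univ G (↑V2 : Set V) f ∧
    (↑X2 : Set V) = {v | v ∈ V2 ∧ (f v = 0 ∨ f v = 1)} ∧
    (↑Y2 : Set V) = {v | v ∈ V2 ∧ (f v = 2 ∨ f v = 3 ∨ f v = 4)}

/-- The base graph of gear strips, on `v1, …, v10` (as `0, …, 9`). -/
def gearH : SimpleGraph (Fin 10) :=
  SimpleGraph.fromEdgeSet
    {s(0, 1), s(1, 2), s(2, 3), s(3, 4), s(4, 5), s(0, 5),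
     s(6, 0), s(6, 1), s(6, 2), s(6, 5),
     s(7, 2), s(7, 3), s(7, 4), s(7, 5), s(7, 6),
     s(8, 0), s(8, 2), s(8, 3), s(8, 5), s(8, 6), s(8, 7),
     s(9, 1), s(9, 2), s(9, 4), s(9, 5), s(9, 6), s(9, 7)}

/-- `(G[V2], X2, Y2)` is a gear strip. -/
def IsGearStripOn (G : SimpleGraph V) (V2 X2 Y2 : Finset V) : Prop :=
  ∃ (Xd : Finset (Fin 10)) (M : Set (Sym2 (Fin 10))) (f : V → Fin 10),
    Xd ⊆ {8, 9} ∧ M ⊆ {s((6 : Fin 10), 7)} ∧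
    IsThickeningBetween gearH M ((↑Xd : Set (Fin 10))ᶜ) G (↑V2 : Set V) f ∧
    (↑X2 : Set V) = {v | v ∈ V2 ∧ (f v = 0 ∨ f v = 1)} ∧
    (↑Y2 : Set V) = {v | v ∈ V2 ∧ (f v = 3 ∨ f v = 4)}

/-! ### The two exceptional three-cliqued classes -/

/-- The base graph of Exception I, on `v1, …, v8` (as `0, …, 7`);
`b` records whether `v2v5` is an edge. -/
def exIG (b : Bool) : SimpleGraph (Fin 8) :=
  SimpleGraph.fromEdgeSet
    ({s(0, 1), s(0, 2), s(0, 5), s(0, 6), s(1, 2), s(1, 3), s(2, 3), s(2, 4), s(3, 4),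
      s(3, 5), s(4, 5), s(5, 6), s(6, 7)} ∪ (if b then {s(1, 4)} else ∅))

/-- The matching of Exception I: `{v1v4, v3v6}`, plus `v2v5` when present. -/
def exIM (b : Bool) : Set (Sym2 (Fin 8)) :=
  {s(0, 3), s(2, 5)} ∪ (if b then {s(1, 4)} else ∅)

/-- The base graph of Exception II, on `v1, …, v9` (as `0, …, 8`); `b24` records
whether `v2v4` is an edge and `b75` whether `v7v5` is an edge. -/
def exIIG (b24 b75 : Bool) : SimpleGraph (Fin 9) :=
  SimpleGraph.fromEdgeSet
    ({s(0, 1), s(6, 7),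
      s(2, 3), s(2, 4), s(2, 5), s(2, 8), s(3, 4), s(3, 5), s(3, 8), s(4, 5), s(4, 8), s(5, 8),
      s(0, 2), s(0, 7), s(0, 8), s(5, 7), s(7, 8), s(1, 2), s(5, 6)}
      ∪ (if b24 then {s(1, 3)} else ∅) ∪ (if b75 then {s(4, 6)} else ∅))

/-! ### Circular interval representations -/

/-- Membership in the (closed) arc from `s` to `t` of the circle `[0,1)`,
going in increasing direction and possibly wrapping around. -/
def ArcMem (s t x : ℝ) : Prop := if s ≤ t then s ≤ x ∧ x ≤ t else (s ≤ x ∨ x ≤ t)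

/-- Adjacency of the fourteen-vertex auxiliary graph: `0..9` are `v1..v10`, `10` is the class
of colours shared by `v7` and `v8`, and `11, 12, 13` are the three types of colours
used on `X1` and `Y1` (both, `X1` only, `Y1` only). -/
def auxEdge (i j : Fin 14) : Bool :=
  match i.val, j.val with
  | 0, 1 => true | 0, 5 => true | 0, 6 => true | 0, 8 => true
  | 0, 10 => true | 0, 11 => true | 0, 12 => true
  | 1, 2 => true | 1, 6 => true | 1, 9 => true
  | 1, 10 => true | 1, 11 => true | 1, 12 => true
  | 2, 3 => true | 2, 6 => true | 2, 7 => true | 2, 8 => true | 2, 9 => true | 2, 10 => true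
  | 3, 4 => true | 3, 7 => true | 3, 8 => true
  | 3, 10 => true | 3, 11 => true | 3, 13 => true
  | 4, 5 => true | 4, 7 => true | 4, 9 => true
  | 4, 10 => true | 4, 11 => true | 4, 13 => true
  | 5, 6 => true | 5, 7 => true | 5, 8 => true | 5, 9 => true | 5, 10 => true
  | 6, 7 => true | 6, 8 => true | 6, 9 => true | 6, 10 => true
  | 7, 8 => true | 7, 9 => true | 7, 10 => true
  | 8, 10 => true
  | 9, 10 => true
  | 11, 12 => true | 11, 13 => true
  | 12, 13 => true
  | _, _ => false

/-- Stable sets of the auxiliary graph. -/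
def Stab (S : Finset (Fin 14)) : Prop := ∀ i ∈ S, ∀ j ∈ S, auxEdge i j = false

instance (S : Finset (Fin 14)) : Decidable (Stab S) := by unfold Stab; infer_instance

/-- `l` stable sets covering each vertex `i` at least `a i` times. -/
def Dec (a : Fin 14 → ℕ) (l : ℕ) : Prop :=
  ∃ F : Fin l → Finset (Fin 14), (∀ j, Stab (F j)) ∧
    ∀ i, a i ≤ (Finset.univ.filter fun j => i ∈ F j).card

/-- The indexing type is irrelevant. -/
lemma Dec.of_type {ι : Type} [Fintype ι] [DecidableEq ι] {a : Fin 14 → ℕ} {l : ℕ}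
    (hl : Fintype.card ι = l) (F : ι → Finset (Fin 14)) (hF : ∀ j, Stab (F j))
    (h : ∀ i, a i ≤ (Finset.univ.filter fun j => i ∈ F j).card) : Dec a l := by
  let e : ι ≃ Fin l := Fintype.equivFinOfCardEq hl
  refine ⟨fun j => F (e.symm j), fun j => hF _, fun i => (h i).trans ?_⟩
  apply Finset.card_le_card_of_injOn e
  · intro j hj
    simpa using hj
  · exact e.injective.injOn

/-- Removing `m` copies of a stable set. -/
lemma Dec.step {a : Fin 14 → ℕ} {l : ℕ} (S : Finset (Fin 14)) (hS : Stab S) (m : ℕ) (hm : m ≤ l)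
    (h : Dec (fun i => if i ∈ S then a i - m else a i) (l - m)) : Dec a l := by
  obtain ⟨F, hF, hc⟩ := h
  refine Dec.of_type (ι := Fin m ⊕ Fin (l - m)) (by simp; omega)
    (Sum.elim (fun _ => S) F) ?_ ?_
  · rintro (j | j)
    · exact hS
    · exact hF j
  · intro i
    have h1 := hc i
    rw [Finset.card_filter] at h1 ⊢
    rw [Fintype.sum_sum_type]
    change _ ≤ (∑ _j : Fin m, if i ∈ S then 1 else 0) + ∑ j, if i ∈ F j then 1 else 0
    by_cases hi : i ∈ S
    · simp only [hi, if_true] at h1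
      simp only [hi, if_true, Finset.sum_const, Finset.card_univ, Fintype.card_fin, smul_eq_mul]
      omega
    · simp only [hi, if_false] at h1
      simp only [hi, if_false, Finset.sum_const, Finset.card_univ, Fintype.card_fin, smul_eq_mul]
      omega

/-- Invariance under automorphisms. -/
lemma Dec.perm {a : Fin 14 → ℕ} {l : ℕ} (σ : Equiv.Perm (Fin 14))
    (hσ : ∀ i j, auxEdge i j = false → auxEdge j i = false →
      auxEdge (σ i) (σ j) = false)
    (h : Dec (fun i => a (σ i)) l) : Dec a l := by
  obtain ⟨F, hF, hc⟩ := h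
  refine ⟨fun j => (F j).map σ.toEmbedding, ?_, ?_⟩
  · intro j i hi k hk
    simp only [Finset.mem_map_equiv] at hi hk
    have := hσ _ _ (hF j _ hi _ hk) (hF j _ hk _ hi)
    simpa using this
  · intro i
    have := hc (σ.symm i)
    simp only [Equiv.apply_symm_apply] at this
    simpa [Finset.mem_map_equiv] using this

/-- Adding guests by Hall's theorem. -/
lemma guest_add {ι : Type} [Fintype ι] [DecidableEq ι] (F : ι → Finset (Fin 14))
    (hF : ∀ j, Stab (F j)) (w : Fin 14 → ℕ)
    (hall : ∀ T : Finset (Fin 14), (∀ g ∈ T, 0 < w g) → T.Nonempty →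
      ∑ g ∈ T, w g ≤ (Finset.univ.filter fun j => ∃ g ∈ T, g ∉ F j ∧ Stab (insert g (F j))).card) :
    ∃ F' : ι → Finset (Fin 14), (∀ j, Stab (F' j)) ∧ (∀ j, F j ⊆ F' j) ∧
      (∀ j, ∀ g ∈ F' j, g ∈ F j ∨ 0 < w g) ∧
      ∀ g, w g + (Finset.univ.filter fun j => g ∈ F j).card ≤
        (Finset.univ.filter fun j => g ∈ F' j).card := by
  classical
  let t : (Σ g : Fin 14, Fin (w g)) → Finset ι :=
    fun x => Finset.univ.filter fun j => x.1 ∉ F j ∧ Stab (insert x.1 (F j))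
  have key := (Finset.all_card_le_biUnion_card_iff_exists_injective t).1 ?_
  · obtain ⟨φ, hinj, hφ⟩ := key
    refine ⟨fun j => F j ∪ Finset.univ.filter fun g => ∃ k, φ ⟨g, k⟩ = j, ?_, ?_, ?_, ?_⟩
    · intro j
      by_cases hj : ∃ x, φ x = j
      · obtain ⟨⟨g, k⟩, hx⟩ := hj
        have e : (F j ∪ Finset.univ.filter fun g => ∃ k, φ ⟨g, k⟩ = j) = insert g (F j) := by
          ext g'
          simp only [Finset.mem_union, Finset.mem_filter, Finset.mem_univ, true_and,
            Finset.mem_insert]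
          constructor
          · rintro (h | ⟨k', h⟩)
            · exact Or.inr h
            · have := hinj (h.trans hx.symm)
              left
              exact congrArg Sigma.fst this
          · rintro (rfl | h)
            · exact Or.inr ⟨k, hx⟩
            · exact Or.inl h
        show Stab (F j ∪ _)
        rw [e]
        have := hφ ⟨g, k⟩
        rw [hx] at this
        exact (by simpa [t] using this : _ ∧ _).2
      · have e : (F j ∪ Finset.univ.filter fun g => ∃ k, φ ⟨g, k⟩ = j) = F j := by
          ext g'
          simp only [Finset.mem_union, Finset.mem_filter, Finset.mem_univ, true_and]
          constructor
          · rintro (h | ⟨k', h⟩)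
            · exact h
            · exact absurd ⟨_, h⟩ hj
          · exact Or.inl
        show Stab (F j ∪ _)
        rw [e]
        exact hF j
    · intro j
      exact Finset.subset_union_left
    · intro j g hg
      simp only [Finset.mem_union, Finset.mem_filter, Finset.mem_univ, true_and] at hg
      rcases hg with h | ⟨k, _⟩
      · exact Or.inl h
      · exact Or.inr (by have := k.2; omega)
    · intro g
      have : w g = (Finset.univ.image fun k : Fin (w g) => φ ⟨g, k⟩).card := by
        rw [Finset.card_image_of_injective]
        · simp
        · intro k k' h
          have := hinj h
          simpa using this
      rw [this, ← Finset.card_union_of_disjoint]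
      · apply Finset.card_le_card
        intro j hj
        simp only [Finset.mem_union, Finset.mem_image, Finset.mem_univ, true_and,
          Finset.mem_filter] at hj ⊢
        exact hj.symm
      · rw [Finset.disjoint_left]
        intro j hj hj'
        simp only [Finset.mem_image, Finset.mem_univ, true_and, Finset.mem_filter] at hj hj'
        obtain ⟨k, rfl⟩ := hj
        have := hφ ⟨g, k⟩
        simp only [t, Finset.mem_filter] at this
        exact this.2.1 hj'
  · intro s
    rcases s.eq_empty_or_nonempty with rfl | hs
    · simp
    have h1 : s ⊆ (s.image Sigma.fst).sigma (fun g => (Finset.univ : Finset (Fin (w g)))) := by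
      intro x hx
      simp only [Finset.mem_sigma, Finset.mem_univ, and_true]
      exact Finset.mem_image_of_mem _ hx
    have h2 := hall (s.image Sigma.fst) (by
      intro g hg
      obtain ⟨⟨g', k⟩, _, rfl⟩ := Finset.mem_image.1 hg
      have := k.2
      simp only
      omega) (hs.image _)
    refine (Finset.card_le_card h1).trans ?_
    rw [Finset.card_sigma]
    simp only [Finset.card_univ, Fintype.card_fin]
    refine h2.trans (Finset.card_le_card ?_)
    intro j hj
    simp only [Finset.mem_filter, Finset.mem_univ, true_and, Finset.mem_image] at hj
    obtain ⟨g, ⟨x, hx, rfl⟩, hst⟩ := hj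
    simp only [Finset.mem_biUnion]
    exact ⟨x, hx, by simpa [t] using hst⟩

/-- The twelve types of colour classes before guests are inserted. -/
def blockSet : Fin 12 → Finset (Fin 14) :=
  ![∅, {0}, {1}, {3}, {4}, {0, 4}, {0, 3}, {1, 3}, {1, 4}, {2, 5}, {8, 9}, {10}]

lemma block_card (c : Fin 12 → ℕ) (P : Fin 12 → Prop) [DecidablePred P] :
    (Finset.univ.filter fun j : (Σ b : Fin 12, Fin (c b)) => P j.1).card =
      ∑ b, if P b then c b else 0 := by
  rw [Finset.card_filter, Fintype.sum_sigma]
  refine Finset.sum_congr rfl fun b _ => ?_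
  by_cases h : P b <;> simp [h]

lemma if_le_if {P Q : Prop} [Decidable P] [Decidable Q] (h : P → Q) (n : ℕ) :
    (if P then n else 0) ≤ (if Q then n else 0) := by
  by_cases hP : P
  · simp [hP, h hP]
  · simp [hP]

lemma sum_fourteen (s : Fin 14 → ℕ) : ∑ g, s g =
    s 0 + s 1 + s 2 + s 3 + s 4 + s 5 + s 6 + s 7 + s 8 + s 9 + s 10 + s 11 + s 12 + s 13 := by
  simp only [Fin.sum_univ_succ, Fin.sum_univ_zero]
  simp
  omega

/-- The final construction: slots, followed by guests. -/
lemma master (a : Fin 14 → ℕ) (l f c1 c2 c4 c5 c15 c14 c24 c25 m36 m910 w3 w6 w9 w10 : ℕ)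
    (hsum : f + c1 + c2 + c4 + c5 + c15 + c14 + c24 + c25 + m36 + m910 + a 10 = l)
    (h1 : a 0 ≤ c1 + c15 + c14) (h2 : a 1 ≤ c2 + c24 + c25)
    (h4 : a 3 ≤ c4 + c14 + c24) (h5 : a 4 ≤ c5 + c15 + c25)
    (h3 : a 2 ≤ w3 + m36) (h6 : a 5 ≤ w6 + m36)
    (h9 : a 8 ≤ w9 + m910) (h10 : a 9 ≤ w10 + m910)
    (hK : a 11 ≤ f + m36 + m910 + a 10)
    (hX : a 11 + a 12 ≤ f + c4 + c5 + m36 + m910 + a 10)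
    (hY : a 11 + a 13 ≤ f + c1 + c2 + m36 + m910 + a 10)
    (hXY : a 11 + a 12 + a 13 ≤ f + c1 + c2 + c4 + c5 + m36 + m910 + a 10)
    (hall : ∀ b3 b6 b7 b8 b9 b10 : Bool,
      (b3 = true → 0 < w3) → (b6 = true → 0 < w6) → (b7 = true → 0 < a 6) →
      (b8 = true → 0 < a 7) → (b9 = true → 0 < w9) → (b10 = true → 0 < w10) →
      (if b3 = true then w3 else 0) + (if b6 = true then w6 else 0) +
      (if b7 = true then a 6 else 0) + (if b8 = true then a 7 else 0) +
      (if b9 = true then w9 else 0) + (if b10 = true then w10 else 0) ≤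
      f + (if b3 = true ∨ b8 = true ∨ b10 = true then c1 else 0) +
      (if b8 = true ∨ b6 = true ∨ b9 = true then c2 else 0) +
      (if b7 = true ∨ b6 = true ∨ b10 = true then c4 else 0) +
      (if b7 = true ∨ b3 = true ∨ b9 = true then c5 else 0) +
      (if b3 = true then c15 else 0) + (if b10 = true then c14 else 0) +
      (if b6 = true then c24 else 0) + (if b9 = true then c25 else 0)) : Dec a l := by
  classical
  let c : Fin 12 → ℕ := ![f, c1, c2, c4, c5, c15, c14, c24, c25, m36, m910, a 10]
  let F : (Σ b : Fin 12, Fin (c b)) → Finset (Fin 14) := fun j => blockSet j.1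
  have hF : ∀ j, Stab (F j) := by
    have : ∀ b, Stab (blockSet b) := by decide
    intro j
    exact this _
  let w : Fin 14 → ℕ := ![0, 0, w3, 0, 0, w6, a 6, a 7, w9, w10, 0, 0, 0, 0]
  have hw : ∀ g, 0 < w g → g = 2 ∨ g = 5 ∨ g = 6 ∨ g = 7 ∨ g = 8 ∨ g = 9 := by
    intro g hg
    fin_cases g <;> simp [w] at hg ⊢
  obtain ⟨F', hF', hsub, hnew, hcnt⟩ := guest_add F hF w (by
    intro T hT hne
    have hfull : ∑ g ∈ T, w g = ∑ g, if g ∈ T then w g else 0 := by simp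
    have hh := hall (decide (2 ∈ T)) (decide (5 ∈ T)) (decide (6 ∈ T)) (decide (7 ∈ T))
      (decide (8 ∈ T)) (decide (9 ∈ T))
      (fun h => hT 2 (by simpa using h)) (fun h => hT 5 (by simpa using h))
      (fun h => hT 6 (by simpa using h)) (fun h => hT 7 (by simpa using h))
      (fun h => hT 8 (by simpa using h)) (fun h => hT 9 (by simpa using h))
    simp only [decide_eq_true_eq] at hh
    have hcard := block_card c (fun b => ∃ g ∈ T, g ∉ blockSet b ∧ Stab (insert g (blockSet b)))
    have hcard' : (Finset.univ.filter fun j => ∃ g ∈ T, g ∉ F j ∧ Stab (insert g (F j))).card =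
        ∑ b, if (∃ g ∈ T, g ∉ blockSet b ∧ Stab (insert g (blockSet b))) then c b else 0 := hcard
    rw [hcard', hfull]
    have hL : (∑ g, if g ∈ T then w g else 0) = (if 2 ∈ T then w3 else 0) +
      (if 5 ∈ T then w6 else 0) + (if 6 ∈ T then a 6 else 0) + (if 7 ∈ T then a 7 else 0) +
      (if 8 ∈ T then w9 else 0) + (if 9 ∈ T then w10 else 0) := by
      rw [sum_fourteen]
      simp [w]
    rw [hL]
    refine hh.trans ?_
    have key : ∀ (b : Fin 12) (P : Prop) [Decidable P],
        (P → ∃ g ∈ T, g ∉ blockSet b ∧ Stab (insert g (blockSet b))) →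
        (if P then c b else 0) ≤
          if (∃ g ∈ T, g ∉ blockSet b ∧ Stab (insert g (blockSet b))) then c b else 0 :=
      fun b P _ h => if_le_if h _
    have k0 := key 0 True (by
      intro _
      obtain ⟨g, hg⟩ := hne
      have d0 : ∀ g : Fin 14, g ∉ blockSet 0 ∧ Stab (insert g (blockSet 0)) := by decide
      exact ⟨g, hg, d0 g⟩)
    have k1 := key 1 (2 ∈ T ∨ 7 ∈ T ∨ 9 ∈ T) (by
      rintro (h | h | h) <;> exact ⟨_, h, by decide⟩)
    have k2 := key 2 (7 ∈ T ∨ 5 ∈ T ∨ 8 ∈ T) (by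
      rintro (h | h | h) <;> exact ⟨_, h, by decide⟩)
    have k3 := key 3 (6 ∈ T ∨ 5 ∈ T ∨ 9 ∈ T) (by
      rintro (h | h | h) <;> exact ⟨_, h, by decide⟩)
    have k4 := key 4 (6 ∈ T ∨ 2 ∈ T ∨ 8 ∈ T) (by
      rintro (h | h | h) <;> exact ⟨_, h, by decide⟩)
    have k5 := key 5 (2 ∈ T) (fun h => ⟨_, h, by decide⟩)
    have k6 := key 6 (9 ∈ T) (fun h => ⟨_, h, by decide⟩)
    have k7 := key 7 (5 ∈ T) (fun h => ⟨_, h, by decide⟩)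
    have k8 := key 8 (8 ∈ T) (fun h => ⟨_, h, by decide⟩)
    rw [if_pos trivial] at k0
    have e : ∀ s : Fin 12 → ℕ, s 0 + s 1 + s 2 + s 3 + s 4 + s 5 + s 6 + s 7 + s 8 ≤ ∑ b, s b := by
      intro s
      simp only [Fin.sum_univ_succ, Fin.sum_univ_zero]
      simp
      omega
    refine le_trans ?_ (e _)
    change f ≤ _ at k0
    change (if _ then c1 else 0) ≤ _ at k1
    change (if _ then c2 else 0) ≤ _ at k2
    change (if _ then c4 else 0) ≤ _ at k3
    change (if _ then c5 else 0) ≤ _ at k4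
    change (if _ then c15 else 0) ≤ _ at k5
    change (if _ then c14 else 0) ≤ _ at k6
    change (if _ then c24 else 0) ≤ _ at k7
    change (if _ then c25 else 0) ≤ _ at k8
    beta_reduce
    have := add_le_add (add_le_add (add_le_add (add_le_add (add_le_add (add_le_add (add_le_add
      (add_le_add k0 k1) k2) k3) k4) k5) k6) k7) k8
    exact this)
  let w' : Fin 14 → ℕ := ![0, 0, 0, 0, 0, 0, 0, 0, 0, 0, 0, a 11, a 12, a 13]
  have hw' : ∀ g, 0 < w' g → g = 11 ∨ g = 12 ∨ g = 13 := by
    intro g hg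
    fin_cases g <;> simp [w'] at hg ⊢
  have hok : ∀ g : Fin 14, (g = 11 ∨ g = 12 ∨ g = 13) → ∀ j,
      (∀ i ∈ blockSet j.1, auxEdge i g = false) → g ∉ F' j ∧ Stab (insert g (F' j)) := by
    intro g hg j hb
    have d1 : ∀ g : Fin 14, (g = 11 ∨ g = 12 ∨ g = 13) → ∀ i : Fin 14,
      (i = 2 ∨ i = 5 ∨ i = 6 ∨ i = 7 ∨ i = 8 ∨ i = 9) →
      auxEdge i g = false ∧ auxEdge g i = false ∧ i ≠ g := by decide
    have d2 : ∀ g : Fin 14, (g = 11 ∨ g = 12 ∨ g = 13) → ∀ b, ∀ i ∈ blockSet b,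
      auxEdge g i = false ∧ i ≠ g := by decide
    have d3 : ∀ g : Fin 14, auxEdge g g = false := by decide
    have hi : ∀ i ∈ F' j, auxEdge i g = false ∧ auxEdge g i = false ∧ i ≠ g := by
      intro i hi
      rcases hnew j i hi with h | h
      · exact ⟨hb i h, d2 g hg _ i h⟩
      · exact d1 g hg i (hw i h)
    refine ⟨fun h => (hi g h).2.2 rfl, ?_⟩
    intro i hi1 i' hi2
    rw [Finset.mem_insert] at hi1 hi2
    rcases hi1 with rfl | hi1 <;> rcases hi2 with rfl | hi2
    · exact d3 _
    · exact (hi _ hi2).2.1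
    · exact (hi _ hi1).1
    · exact hF' j _ hi1 _ hi2
  obtain ⟨F'', hF'', hsub'', -, hcnt''⟩ := guest_add F' hF' w' (by
    intro T hT hne
    have hT' : ∀ g ∈ T, g = 11 ∨ g = 12 ∨ g = 13 := fun g hg => hw' g (hT g hg)
    have hfull : ∑ g ∈ T, w' g = ∑ g, if g ∈ T then w' g else 0 := by simp
    have hL : (∑ g, if g ∈ T then w' g else 0) = (if 11 ∈ T then a 11 else 0) +
      (if 12 ∈ T then a 12 else 0) + (if 13 ∈ T then a 13 else 0) := by
      rw [sum_fourteen]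
      simp [w']
    have hcard := block_card c (fun b => ∃ g ∈ T, ∀ i ∈ blockSet b, auxEdge i g = false)
    have hle : (Finset.univ.filter fun j : (Σ b : Fin 12, Fin (c b)) =>
        ∃ g ∈ T, ∀ i ∈ blockSet j.1, auxEdge i g = false).card ≤
        (Finset.univ.filter fun j => ∃ g ∈ T, g ∉ F' j ∧ Stab (insert g (F' j))).card := by
      apply Finset.card_le_card
      intro j hj
      simp only [Finset.mem_filter, Finset.mem_univ, true_and] at hj ⊢
      obtain ⟨g, hg, hj⟩ := hj
      exact ⟨g, hg, hok g (hT' g hg) j hj⟩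
    refine le_trans ?_ hle
    rw [hcard, hfull, hL]
    have key : ∀ (b : Fin 12) (P : Prop) [Decidable P],
        (P → ∃ g ∈ T, ∀ i ∈ blockSet b, auxEdge i g = false) →
        (if P then c b else 0) ≤
          if (∃ g ∈ T, ∀ i ∈ blockSet b, auxEdge i g = false) then c b else 0 :=
      fun b P _ h => if_le_if h _
    have dfree : ∀ b : Fin 12, (b = 0 ∨ b = 9 ∨ b = 10 ∨ b = 11) →
        ∀ g : Fin 14, (g = 11 ∨ g = 12 ∨ g = 13) →
        ∀ i ∈ blockSet b, auxEdge i g = false := by decide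
    have kfree : ∀ b : Fin 12, (b = 0 ∨ b = 9 ∨ b = 10 ∨ b = 11) →
        c b ≤ if (∃ g ∈ T, ∀ i ∈ blockSet b, auxEdge i g = false) then c b else 0 := by
      intro b hb
      have := key b True (by
        intro _
        obtain ⟨g, hg⟩ := hne
        exact ⟨g, hg, dfree b hb g (hT' g hg)⟩)
      rwa [if_pos trivial] at this
    have k0 := kfree 0 (by decide)
    have k9 := kfree 9 (by decide)
    have k10 := kfree 10 (by decide)
    have k11 := kfree 11 (by decide)
    have k1 := key 1 (13 ∈ T) (fun h => ⟨_, h, by decide⟩)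
    have k2 := key 2 (13 ∈ T) (fun h => ⟨_, h, by decide⟩)
    have k3 := key 3 (12 ∈ T) (fun h => ⟨_, h, by decide⟩)
    have k4 := key 4 (12 ∈ T) (fun h => ⟨_, h, by decide⟩)
    have e : ∀ s : Fin 12 → ℕ, s 0 + s 1 + s 2 + s 3 + s 4 + s 9 + s 10 + s 11 ≤ ∑ b, s b := by
      intro s
      simp only [Fin.sum_univ_succ, Fin.sum_univ_zero]
      simp
      omega
    refine le_trans ?_ (e _)
    beta_reduce
    have := add_le_add (add_le_add (add_le_add (add_le_add (add_le_add (add_le_add (add_le_add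
      k0 k1) k2) k3) k4) k9) k10) k11
    refine le_trans ?_ this
    change _ ≤ f + (if _ then c1 else 0) + (if _ then c2 else 0) + (if _ then c4 else 0)
      + (if _ then c5 else 0) + m36 + m910 + a 10
    by_cases t1 : (11 : Fin 14) ∈ T <;> by_cases t2 : (12 : Fin 14) ∈ T <;>
      by_cases t3 : (13 : Fin 14) ∈ T <;> simp only [t1, t2, t3, if_true, if_false] <;> omega)
  refine Dec.of_type (ι := Σ b : Fin 12, Fin (c b)) ?_ F'' hF'' ?_
  · rw [Fintype.card_sigma]
    simp only [Fintype.card_fin, Fin.sum_univ_succ, Fin.sum_univ_zero]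
    simp [c]
    omega
  · intro i
    have q1 := hcnt i
    have q2 := hcnt'' i
    have q3 := block_card c (fun b => i ∈ blockSet b)
    have q3' : (Finset.univ.filter fun j => i ∈ F j).card =
        ∑ b, if i ∈ blockSet b then c b else 0 := q3
    rw [q3'] at q1
    refine le_trans ?_ q2
    refine le_trans ?_ (Nat.add_le_add_left q1 _)
    fin_cases i <;> simp [Fin.sum_univ_succ, w, w', c, blockSet] <;> omega

/-- The linear inequalities given by the local bound, for the auxiliary demands `a`. -/
structure Con (a : Fin 14 → ℕ) (l : ℕ) : Prop where
  tot : a 11 + a 12 + a 13 ≤ l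
  q1a : (a 0 + a 1 + a 5 + a 8 + a 6 + a 10 + a 11 + a 12) +
    (a 0 + a 1 + a 11 + a 12) ≤ 2 * l
  q1b : (a 0 + a 1 + a 5 + a 8 + a 6 + a 10 + a 11 + a 12) +
    (a 0 + a 1 + a 6 + a 10) ≤ 2 * l
  q1c : (a 0 + a 1 + a 5 + a 8 + a 6 + a 10 + a 11 + a 12) +
    (a 0 + a 5 + a 8 + a 6 + a 10) ≤ 2 * l
  q2a : (a 0 + a 1 + a 2 + a 9 + a 6 + a 10 + a 11 + a 12) +
    (a 0 + a 1 + a 11 + a 12) ≤ 2 * l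
  q2b : (a 0 + a 1 + a 2 + a 9 + a 6 + a 10 + a 11 + a 12) +
    (a 0 + a 1 + a 6 + a 10) ≤ 2 * l
  q2c : (a 0 + a 1 + a 2 + a 9 + a 6 + a 10 + a 11 + a 12) +
    (a 1 + a 2 + a 9 + a 6 + a 10) ≤ 2 * l
  q3a : (a 1 + a 2 + a 3 + a 8 + a 9 + a 6 + a 7 + a 10 + a 10) +
    (a 1 + a 2 + a 9 + a 6 + a 10) ≤ 2 * l
  q3b : (a 1 + a 2 + a 3 + a 8 + a 9 + a 6 + a 7 + a 10 + a 10) +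
    (a 2 + a 3 + a 8 + a 7 + a 10) ≤ 2 * l
  q3c : (a 1 + a 2 + a 3 + a 8 + a 9 + a 6 + a 7 + a 10 + a 10) +
    (a 2 + a 6 + a 7 + a 8 + a 10) ≤ 2 * l
  q3d : (a 1 + a 2 + a 3 + a 8 + a 9 + a 6 + a 7 + a 10 + a 10) +
    (a 2 + a 6 + a 7 + a 9 + a 10) ≤ 2 * l
  q4a : (a 2 + a 3 + a 4 + a 8 + a 7 + a 10 + a 11 + a 13) +
    (a 3 + a 4 + a 11 + a 13) ≤ 2 * l
  q4b : (a 2 + a 3 + a 4 + a 8 + a 7 + a 10 + a 11 + a 13) +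
    (a 3 + a 4 + a 7 + a 10) ≤ 2 * l
  q4c : (a 2 + a 3 + a 4 + a 8 + a 7 + a 10 + a 11 + a 13) +
    (a 2 + a 3 + a 8 + a 7 + a 10) ≤ 2 * l
  q5a : (a 3 + a 4 + a 5 + a 9 + a 7 + a 10 + a 11 + a 13) +
    (a 3 + a 4 + a 11 + a 13) ≤ 2 * l
  q5b : (a 3 + a 4 + a 5 + a 9 + a 7 + a 10 + a 11 + a 13) +
    (a 3 + a 4 + a 7 + a 10) ≤ 2 * l
  q5c : (a 3 + a 4 + a 5 + a 9 + a 7 + a 10 + a 11 + a 13) +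
    (a 4 + a 5 + a 9 + a 7 + a 10) ≤ 2 * l
  q6a : (a 0 + a 4 + a 5 + a 8 + a 9 + a 6 + a 7 + a 10 + a 10) +
    (a 0 + a 5 + a 8 + a 6 + a 10) ≤ 2 * l
  q6b : (a 0 + a 4 + a 5 + a 8 + a 9 + a 6 + a 7 + a 10 + a 10) +
    (a 4 + a 5 + a 9 + a 7 + a 10) ≤ 2 * l
  q6c : (a 0 + a 4 + a 5 + a 8 + a 9 + a 6 + a 7 + a 10 + a 10) +
    (a 5 + a 6 + a 7 + a 8 + a 10) ≤ 2 * l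
  q6d : (a 0 + a 4 + a 5 + a 8 + a 9 + a 6 + a 7 + a 10 + a 10) +
    (a 5 + a 6 + a 7 + a 9 + a 10) ≤ 2 * l
  q7a : (a 0 + a 1 + a 2 + a 5 + a 8 + a 9 + a 6 + a 7 + a 10) +
    (a 0 + a 1 + a 6 + a 10) ≤ 2 * l
  q7b : (a 0 + a 1 + a 2 + a 5 + a 8 + a 9 + a 6 + a 7 + a 10) +
    (a 0 + a 5 + a 8 + a 6 + a 10) ≤ 2 * l
  q7c : (a 0 + a 1 + a 2 + a 5 + a 8 + a 9 + a 6 + a 7 + a 10) +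
    (a 1 + a 2 + a 9 + a 6 + a 10) ≤ 2 * l
  q7d : (a 0 + a 1 + a 2 + a 5 + a 8 + a 9 + a 6 + a 7 + a 10) +
    (a 2 + a 6 + a 7 + a 8 + a 10) ≤ 2 * l
  q7e : (a 0 + a 1 + a 2 + a 5 + a 8 + a 9 + a 6 + a 7 + a 10) +
    (a 2 + a 6 + a 7 + a 9 + a 10) ≤ 2 * l
  q7f : (a 0 + a 1 + a 2 + a 5 + a 8 + a 9 + a 6 + a 7 + a 10) +
    (a 5 + a 6 + a 7 + a 8 + a 10) ≤ 2 * l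
  q7g : (a 0 + a 1 + a 2 + a 5 + a 8 + a 9 + a 6 + a 7 + a 10) +
    (a 5 + a 6 + a 7 + a 9 + a 10) ≤ 2 * l
  q8a : (a 2 + a 3 + a 4 + a 5 + a 8 + a 9 + a 6 + a 7 + a 10) +
    (a 3 + a 4 + a 7 + a 10) ≤ 2 * l
  q8b : (a 2 + a 3 + a 4 + a 5 + a 8 + a 9 + a 6 + a 7 + a 10) +
    (a 2 + a 3 + a 8 + a 7 + a 10) ≤ 2 * l
  q8c : (a 2 + a 3 + a 4 + a 5 + a 8 + a 9 + a 6 + a 7 + a 10) +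
    (a 4 + a 5 + a 9 + a 7 + a 10) ≤ 2 * l
  q8d : (a 2 + a 3 + a 4 + a 5 + a 8 + a 9 + a 6 + a 7 + a 10) +
    (a 2 + a 6 + a 7 + a 8 + a 10) ≤ 2 * l
  q8e : (a 2 + a 3 + a 4 + a 5 + a 8 + a 9 + a 6 + a 7 + a 10) +
    (a 2 + a 6 + a 7 + a 9 + a 10) ≤ 2 * l
  q8f : (a 2 + a 3 + a 4 + a 5 + a 8 + a 9 + a 6 + a 7 + a 10) +
    (a 5 + a 6 + a 7 + a 8 + a 10) ≤ 2 * l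
  q8g : (a 2 + a 3 + a 4 + a 5 + a 8 + a 9 + a 6 + a 7 + a 10) +
    (a 5 + a 6 + a 7 + a 9 + a 10) ≤ 2 * l

set_option linter.unusedSimpArgs false

set_option maxHeartbeats 4000000 in
lemma regimeB (a : Fin 14 → ℕ) (l : ℕ) (h : Con a l)
    (hn : a 11 + a 12 + a 13 = l) : Dec a l := by
  obtain ⟨tot, q1a, q1b, q1c, q2a, q2b, q2c, q3a, q3b, q3c, q3d, q4a, q4b, q4c, q5a, q5b, q5c,
    q6a, q6b, q6c, q6d, q7a, q7b, q7c, q7d, q7e, q7f, q7g, q8a, q8b, q8c, q8d, q8e, q8f, q8g⟩ := h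
  have g1 : a 0 + a 1 + a 11 + a 12 ≤ l := by linarith
  have g2 : a 3 + a 4 + a 11 + a 13 ≤ l := by linarith
  have g3 : 2 * a 0 + 2 * a 1 + 2 * a 3 + 2 * a 4 + 2 * a 2 + 2 * a 10 + a 8 + a 9 + a 6 + a 7 ≤ 2 * l := by linarith
  have g4 : 2 * a 0 + 2 * a 1 + 2 * a 3 + 2 * a 4 + 2 * a 5 + 2 * a 10 + a 8 + a 9 + a 6 + a 7 ≤ 2 * l := by linarith
  have g5 : 2 * a 0 + 2 * a 1 + 2 * a 3 + 2 * a 4 + a 2 + a 5 + 2 * a 10 + 2 * a 8 + a 6 + a 7 ≤ 2 * l := by linarith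
  have g6 : 2 * a 0 + 2 * a 1 + 2 * a 3 + 2 * a 4 + a 2 + a 5 + 2 * a 10 + 2 * a 9 + a 6 + a 7 ≤ 2 * l := by linarith
  have g7 : a 0 + a 1 + a 6 + a 10 ≤ l := by linarith
  have g8 : a 3 + a 4 + a 7 + a 10 ≤ l := by linarith
  have g9 : a 2 + a 3 + a 8 + a 7 + a 10 ≤ l := by linarith
  have g10 : a 4 + a 5 + a 9 + a 7 + a 10 ≤ l := by linarith
  have g11 : a 0 + a 5 + a 8 + a 6 + a 10 ≤ l := by linarith
  have g12 : a 1 + a 2 + a 9 + a 6 + a 10 ≤ l := by linarith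
  have g13 : a 2 + a 6 + a 7 + a 8 + a 10 ≤ l := by linarith
  have g14 : a 2 + a 6 + a 7 + a 9 + a 10 ≤ l := by linarith
  have g15 : a 5 + a 6 + a 7 + a 8 + a 10 ≤ l := by linarith
  have g16 : a 5 + a 6 + a 7 + a 9 + a 10 ≤ l := by linarith
  have g17 : 2 * a 3 + 2 * a 4 + 2 * a 10 + 2 * a 7 + a 2 + a 5 + a 8 + a 9 ≤ 2 * l := by linarith
  have g18 : 2 * a 0 + 2 * a 1 + 2 * a 10 + 2 * a 6 + a 2 + a 5 + a 8 + a 9 ≤ 2 * l := by linarith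
  have hF : a 0 + a 1 + a 3 + a 4 + a 10 ≤ l := by linarith
  clear q1a q1b q1c q2a q2b q2c q3a q3b q3c q3d q4a q4b q4c q5a q5b q5c q6a q6b q6c q6d
  clear q7a q7b q7c q7d q7e q7f q7g q8a q8b q8c q8d q8e q8f q8g
  obtain ⟨F, hF⟩ := Nat.exists_eq_add_of_le hF
  obtain ⟨m36, w3, w6, e3, e6, hm36, hd⟩ : ∃ m w3 w6, a 2 = w3 + m ∧ a 5 = w6 + m ∧
      m ≤ F ∧ (w3 = 0 ∨ w6 = 0 ∨ m = F) :=
    ⟨min (min (a 2) (a 5)) F, a 2 - min (min (a 2) (a 5)) F, a 5 - min (min (a 2) (a 5)) F,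
      by omega, by omega, by omega, by omega⟩
  obtain ⟨F1, hF1⟩ := Nat.exists_eq_add_of_le hm36
  obtain ⟨m910, w9, w10, e9, e10, hm910, hd'⟩ : ∃ m w3 w6, a 8 = w3 + m ∧ a 9 = w6 + m ∧
      m ≤ F1 ∧ (w3 = 0 ∨ w6 = 0 ∨ m = F1) :=
    ⟨min (min (a 8) (a 9)) F1, a 8 - min (min (a 8) (a 9)) F1, a 9 - min (min (a 8) (a 9)) F1,
      by omega, by omega, by omega, by omega⟩
  obtain ⟨F2, hF2⟩ := Nat.exists_eq_add_of_le hm910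
  refine master a l F2 (a 0) (a 1) (a 3) (a 4) 0 0 0 0 m36 m910 w3 w6 w9 w10
    (by omega) (by omega) (by omega) (by omega) (by omega) (by omega) (by omega) (by omega) (by omega) (by omega) (by omega) (by omega) (by omega) ?_
  clear g1 g2 hn tot
  intro b3 b6 b7 b8 b9 b10 p3 p6 p7 p8 p9 p10
  cases b3 <;> cases b6 <;> cases b7 <;> cases b8 <;> cases b9 <;> cases b10 <;>
    simp only [if_true, if_false, Bool.false_eq_true, true_or, or_true, or_false,
      forall_true_left] at p3 p6 p9 p10 ⊢ <;> omega

set_option maxHeartbeats 4000000 in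
lemma regimeC (a : Fin 14 → ℕ) (l : ℕ) (h : Con a l)
    (h0 : a 0 = 0) (h1 : a 1 = 0) : Dec a l := by
  obtain ⟨tot, q1a, q1b, q1c, q2a, q2b, q2c, q3a, q3b, q3c, q3d, q4a, q4b, q4c, q5a, q5b, q5c,
    q6a, q6b, q6c, q6d, q7a, q7b, q7c, q7d, q7e, q7f, q7g, q8a, q8b, q8c, q8d, q8e, q8f, q8g⟩ := h
  have g1 : a 4 + a 5 + a 7 + a 9 + a 10 ≤ l := by linarith
  have g2 : a 2 + a 3 + a 7 + a 8 + a 10 ≤ l := by linarith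
  have g3 : a 2 + a 6 + a 7 + a 8 + a 10 ≤ l := by linarith
  have g4 : a 2 + a 6 + a 7 + a 9 + a 10 ≤ l := by linarith
  have g5 : a 5 + a 6 + a 7 + a 8 + a 10 ≤ l := by linarith
  have g6 : a 5 + a 6 + a 7 + a 9 + a 10 ≤ l := by linarith
  have g7 : a 2 + a 3 + a 4 + a 5 + a 6 + 2 * a 7 + a 8 + a 9 + 2 * a 10 ≤ 2 * l := by linarith
  have g8 : a 3 + a 4 + a 11 + a 13 ≤ l := by linarith
  have hF : a 3 + a 4 + a 10 + a 7 ≤ l := by linarith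
  clear q1a q1b q1c q2a q2b q2c q3a q3b q3c q3d q4a q4b q4c q5a q5b q5c q6a q6b q6c q6d
  clear q7a q7b q7c q7d q7e q7f q7g q8a q8b q8c q8d q8e q8f q8g
  obtain ⟨F, hF⟩ := Nat.exists_eq_add_of_le hF
  obtain ⟨m36, w3, w6, e3, e6, hm36, hd⟩ : ∃ m w3 w6, a 2 = w3 + m ∧ a 5 = w6 + m ∧
      m ≤ F ∧ (w3 = 0 ∨ w6 = 0 ∨ m = F) :=
    ⟨min (min (a 2) (a 5)) F, a 2 - min (min (a 2) (a 5)) F, a 5 - min (min (a 2) (a 5)) F,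
      by omega, by omega, by omega, by omega⟩
  obtain ⟨F1, hF1⟩ := Nat.exists_eq_add_of_le hm36
  obtain ⟨m910, w9, w10, e9, e10, hm910, hd'⟩ : ∃ m w3 w6, a 8 = w3 + m ∧ a 9 = w6 + m ∧
      m ≤ F1 ∧ (w3 = 0 ∨ w6 = 0 ∨ m = F1) :=
    ⟨min (min (a 8) (a 9)) F1, a 8 - min (min (a 8) (a 9)) F1, a 9 - min (min (a 8) (a 9)) F1,
      by omega, by omega, by omega, by omega⟩
  obtain ⟨F2, hF2⟩ := Nat.exists_eq_add_of_le hm910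
  refine master a l (F2 + a 7) 0 0 (a 3) (a 4) 0 0 0 0 m36 m910 w3 w6 w9 w10
    (by omega) (by omega) (by omega) (by omega) (by omega) (by omega) (by omega) (by omega) (by omega) (by omega) (by omega) (by omega) (by omega) ?_
  clear h0 h1 g8 tot
  intro b3 b6 b7 b8 b9 b10 p3 p6 p7 p8 p9 p10
  cases b3 <;> cases b6 <;> cases b7 <;> cases b8 <;> cases b9 <;> cases b10 <;>
    simp only [if_true, if_false, Bool.false_eq_true, true_or, or_true, or_false,
      forall_true_left] at p3 p6 p9 p10 ⊢ <;> omega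

set_option maxHeartbeats 4000000 in
lemma regimeD (a : Fin 14 → ℕ) (l : ℕ) (h : Con a l)
    (h0 : a 0 = 0) (h3 : a 3 = 0) (h8 : a 8 = 0) : Dec a l := by
  obtain ⟨tot, q1a, q1b, q1c, q2a, q2b, q2c, q3a, q3b, q3c, q3d, q4a, q4b, q4c, q5a, q5b, q5c,
    q6a, q6b, q6c, q6d, q7a, q7b, q7c, q7d, q7e, q7f, q7g, q8a, q8b, q8c, q8d, q8e, q8f, q8g⟩ := h
  have g1 : a 1 + a 11 + a 12 ≤ l := by linarith
  have g2 : a 4 + a 11 + a 13 ≤ l := by linarith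
  have g3 : a 1 + a 4 + a 9 + a 10 + a 11 + a 12 + a 13 ≤ 2 * l := by linarith
  have g4 : a 4 + a 5 + a 7 + a 9 + a 10 ≤ l := by linarith
  have g5 : a 2 + a 6 + a 7 + a 9 + a 10 ≤ l := by linarith
  have g6 : a 1 + a 2 + a 6 + a 9 + a 10 ≤ l := by linarith
  have g7 : a 5 + a 6 + a 7 + a 9 + a 10 ≤ l := by linarith
  have g8 : a 1 + a 4 + a 5 + a 6 + a 7 + a 9 + a 10 + a 11 ≤ 2 * l := by linarith
  have g9 : a 1 + a 4 + a 2 + a 6 + a 7 + a 9 + a 10 + a 11 ≤ 2 * l := by linarith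
  clear q1a q1b q1c q2a q2b q2c q3a q3b q3c q3d q4a q4b q4c q5a q5b q5c q6a q6b q6c q6d
  clear q7a q7b q7c q7d q7e q7f q7g q8a q8b q8c q8d q8e q8f q8g
  obtain ⟨r, r1, r2, r3, r4, r5, r6⟩ : ∃ r, a 1 + a 4 + a 10 + a 9 ≤ l + r ∧
      a 1 + a 4 + a 11 ≤ l + r ∧ r ≤ a 1 ∧ r ≤ a 4 ∧ r + a 11 + a 12 + a 13 ≤ l ∧
      (r = 0 ∨ a 1 + a 4 + a 10 + a 9 = l + r ∨ a 1 + a 4 + a 11 = l + r) :=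
    ⟨max (a 1 + a 4 + a 10 + a 9 - l) (a 1 + a 4 + a 11 - l),
      by omega, by omega, by omega, by omega, by omega, by omega⟩
  obtain ⟨c, hc⟩ := Nat.exists_eq_add_of_le r3
  obtain ⟨d, hd0⟩ := Nat.exists_eq_add_of_le r4
  obtain ⟨F, hF⟩ := Nat.exists_eq_add_of_le r1
  obtain ⟨m36, w3, w6, e3, e6, hm36, hd⟩ : ∃ m w3 w6, a 2 = w3 + m ∧ a 5 = w6 + m ∧
      m ≤ F ∧ (w3 = 0 ∨ w6 = 0 ∨ m = F) :=
    ⟨min (min (a 2) (a 5)) F, a 2 - min (min (a 2) (a 5)) F, a 5 - min (min (a 2) (a 5)) F,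
      by omega, by omega, by omega, by omega⟩
  obtain ⟨F1, hF1⟩ := Nat.exists_eq_add_of_le hm36
  refine master a l (F1 + a 9) 0 c 0 d 0 0 0 r m36 0 w3 w6 0 (a 9)
    (by omega) (by omega) (by omega) (by omega) (by omega) (by omega) (by omega) (by omega) (by omega) (by omega) (by omega) (by omega) (by omega) ?_
  clear h0 h3 h8 g1 g2 g3 tot r5
  intro b3 b6 b7 b8 b9 b10 p3 p6 p7 p8 p9 p10
  cases b3 <;> cases b6 <;> cases b7 <;> cases b8 <;> cases b9 <;> cases b10 <;>
    simp only [if_true, if_false, Bool.false_eq_true, true_or, or_true, or_false,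
      forall_true_left] at p3 p6 p9 p10 ⊢ <;> omega

set_option maxHeartbeats 4000000 in
lemma regimeE (a : Fin 14 → ℕ) (l : ℕ) (h : Con a l)
    (h0 : a 0 = 0) (h4 : a 4 = 0) (h5 : a 5 = 0) : Dec a l := by
  obtain ⟨tot, q1a, q1b, q1c, q2a, q2b, q2c, q3a, q3b, q3c, q3d, q4a, q4b, q4c, q5a, q5b, q5c,
    q6a, q6b, q6c, q6d, q7a, q7b, q7c, q7d, q7e, q7f, q7g, q8a, q8b, q8c, q8d, q8e, q8f, q8g⟩ := h
  have g1 : a 1 + a 11 + a 12 ≤ l := by linarith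
  have g2 : a 3 + a 11 + a 13 ≤ l := by linarith
  have g3 : a 1 + a 2 + a 3 + a 10 + a 11 + a 12 + a 13 ≤ 2 * l := by linarith
  have g4 : a 2 + a 3 + a 7 + a 8 + a 10 ≤ l := by linarith
  have g5 : a 2 + a 6 + a 7 + a 9 + a 10 ≤ l := by linarith
  have g6 : a 1 + a 2 + a 6 + a 9 + a 10 ≤ l := by linarith
  have g7 : a 2 + a 6 + a 7 + a 8 + a 10 ≤ l := by linarith
  have g8 : a 1 + a 3 + a 2 + a 6 + a 7 + a 8 + a 10 + a 11 ≤ 2 * l := by linarith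
  have g9 : a 1 + a 3 + a 2 + a 6 + a 7 + a 9 + a 10 + a 11 ≤ 2 * l := by linarith
  clear q1a q1b q1c q2a q2b q2c q3a q3b q3c q3d q4a q4b q4c q5a q5b q5c q6a q6b q6c q6d
  clear q7a q7b q7c q7d q7e q7f q7g q8a q8b q8c q8d q8e q8f q8g
  obtain ⟨r, r1, r2, r3, r4, r5, r6⟩ : ∃ r, a 1 + a 3 + a 10 + a 2 ≤ l + r ∧
      a 1 + a 3 + a 11 ≤ l + r ∧ r ≤ a 1 ∧ r ≤ a 3 ∧ r + a 11 + a 12 + a 13 ≤ l ∧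
      (r = 0 ∨ a 1 + a 3 + a 10 + a 2 = l + r ∨ a 1 + a 3 + a 11 = l + r) :=
    ⟨max (a 1 + a 3 + a 10 + a 2 - l) (a 1 + a 3 + a 11 - l),
      by omega, by omega, by omega, by omega, by omega, by omega⟩
  obtain ⟨c, hc⟩ := Nat.exists_eq_add_of_le r3
  obtain ⟨d, hd0⟩ := Nat.exists_eq_add_of_le r4
  obtain ⟨F, hF⟩ := Nat.exists_eq_add_of_le r1
  obtain ⟨m910, w9, w10, e9, e10, hm910, hd'⟩ : ∃ m w3 w6, a 8 = w3 + m ∧ a 9 = w6 + m ∧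
      m ≤ F ∧ (w3 = 0 ∨ w6 = 0 ∨ m = F) :=
    ⟨min (min (a 8) (a 9)) F, a 8 - min (min (a 8) (a 9)) F, a 9 - min (min (a 8) (a 9)) F,
      by omega, by omega, by omega, by omega⟩
  obtain ⟨F1, hF1⟩ := Nat.exists_eq_add_of_le hm910
  refine master a l (F1 + a 2) 0 c d 0 0 0 r 0 0 m910 (a 2) 0 w9 w10
    (by omega) (by omega) (by omega) (by omega) (by omega) (by omega) (by omega) (by omega) (by omega) (by omega) (by omega) (by omega) (by omega) ?_
  clear h0 h4 h5 g1 g2 g3 tot r5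
  intro b3 b6 b7 b8 b9 b10 p3 p6 p7 p8 p9 p10
  cases b3 <;> cases b6 <;> cases b7 <;> cases b8 <;> cases b9 <;> cases b10 <;>
    simp only [if_true, if_false, Bool.false_eq_true, true_or, or_true, or_false,
      forall_true_left] at p3 p6 p9 p10 ⊢ <;> omega

lemma exists_pair (L1 U1 L2 U2 L3 U3 : ℕ) (h1 : L1 ≤ U1) (h2 : L2 ≤ U2) (h3 : L1 + L2 ≤ U3)
    (h4 : L3 ≤ U1 + U2) (h5 : L3 ≤ U3) :
    ∃ c d, L1 ≤ c ∧ c ≤ U1 ∧ L2 ≤ d ∧ d ≤ U2 ∧ L3 ≤ c + d ∧ c + d ≤ U3 := by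
  by_cases h : L3 ≤ L1 + L2
  · exact ⟨L1, L2, by omega, by omega, by omega, by omega, by omega, by omega⟩
  · by_cases h' : L3 ≤ U1 + L2
    · exact ⟨L3 - L2, L2, by omega, by omega, by omega, by omega, by omega, by omega⟩
    · exact ⟨U1, L3 - U1, by omega, by omega, by omega, by omega, by omega, by omega⟩

lemma regimeF_pair (p2 p3 p4 p5 p7 p8 p10 z k x y l : ℕ)
    (i1 : p2 + p3 + z ≤ l)
    (i2 : p5 + p8 + p10 + z ≤ l)
    (i3 : p2 + p3 + p4 + p5 + p8 + p10 + 2 * z ≤ 2 * l)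
    (i4 : p2 + p10 + z ≤ l)
    (i5 : p3 + p4 + p8 + z ≤ l)
    (i6 : p2 + p5 + p10 + p4 + p8 + p3 + 2 * z ≤ 2 * l)
    (i7 : p3 + p4 + z ≤ l)
    (i8 : p5 + p10 + z ≤ l)
    (i9 : p2 + p3 + p4 + z + p5 + p10 + z ≤ 2 * l)
    (i10 : p2 + p3 + p4 + z + k + x + y ≤ 2 * l)
    (i11 : p2 + p5 + p10 + z + k + x + y ≤ 2 * l)
    (i12 : 2 * p2 + p3 + p4 + p5 + p10 + 2 * z + k + x + y ≤ 3 * l)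
    (i13 : k + x + y ≤ l)
    (i14 : p3 + p7 + p8 + p10 + z ≤ l)
    (i15 : p2 + 2 * p3 + p4 + 2 * z + p7 + p8 + p10 ≤ 2 * l)
    (i16 : p2 + p5 + 2 * p10 + 2 * z + p7 + p8 + p3 ≤ 2 * l)
    (i17 : 2 * p2 + 2 * p3 + p4 + p5 + 2 * p10 + 3 * z + p7 + p8 ≤ 3 * l)
    (i18 : p2 + z ≤ l)
    (i19 : p2 + k ≤ l)
    (i20 : p2 + p5 + p4 + 2 * z + p8 + p3 ≤ 2 * l)
    (i21 : p2 + p5 + p4 + k + z + p8 + p3 ≤ 2 * l)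
    (i22 : p2 + p5 + p4 + 2 * z + p8 + p10 ≤ 2 * l)
    (i23 : p2 + p5 + p4 + z + k + p8 + p10 ≤ 2 * l)
    (i24 : p2 + 2 * p4 + 2 * p5 + 3 * z + 2 * p8 + p10 + p3 ≤ 3 * l)
    (i25 : p2 + 2 * p4 + 2 * p5 + 2 * z + k + 2 * p8 + p10 + p3 ≤ 3 * l)
    (i26 : p4 + p5 + z ≤ l)
    (i27 : p4 + p5 + k ≤ l)
    (i28 : p2 + p4 + p5 + z + k + x + y ≤ 2 * l)
    (i29 : p2 + p4 + p5 + 2 * k + x + y ≤ 2 * l)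
    (i30 : p2 + p4 + p5 + 2 * z + p7 + p8 + p3 + p10 ≤ 2 * l)
    (i31 : p2 + p4 + p5 + k + z + p7 + p8 + p3 + p10 ≤ 2 * l) :
    ∃ c d, p2 + p3 + p4 + z ≤ l + c ∧ c ≤ p4 ∧ c + (p5 + z + p8 + p10) ≤ l ∧
      p2 + p5 + p10 + z ≤ l + d ∧ d ≤ p5 ∧ d + (p4 + z + p8 + p3) ≤ l ∧
      p2 + p4 + p5 + z ≤ l + (c + d) ∧ p2 + p4 + p5 + k ≤ l + (c + d) ∧ c + d ≤ p2 ∧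
      c + d + (k + x + y) ≤ l ∧ c + d + (z + p7 + p8 + p3 + p10) ≤ l := by
  obtain ⟨c, d, r1, r2, r3, r4, r5, r6⟩ := exists_pair
    (p2 + p3 + p4 + z - l) (min p4 (l - (p5 + z + p8 + p10)))
    (p2 + p5 + p10 + z - l) (min p5 (l - (p4 + z + p8 + p3)))
    (max (p2 + p4 + p5 + z - l) (p2 + p4 + p5 + k - l))
    (min (min p2 (l - (k + x + y))) (l - (z + p7 + p8 + p3 + p10)))
    (by clear i4 i5 i6 i7 i8 i9 i10 i11 i12 i13 i14 i15 i16 i17 i18 i19 i20 i21 i22 i23 i24 i25 i26 i27 i28 i29 i30 i31; omega)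
    (by clear i1 i2 i3 i7 i8 i9 i10 i11 i12 i13 i14 i15 i16 i17 i18 i19 i20 i21 i22 i23 i24 i25 i26 i27 i28 i29 i30 i31; omega)
    (by clear i1 i2 i3 i4 i5 i6 i18 i19 i20 i21 i22 i23 i24 i25 i26 i27 i28 i29 i30 i31; omega)
    (by clear i1 i3 i4 i6 i7 i8 i9 i10 i11 i12 i13 i14 i15 i16 i17 i26 i27 i28 i29 i30 i31; omega)
    (by clear i1 i2 i3 i4 i5 i6 i7 i8 i9 i10 i11 i12 i15 i16 i17 i18 i19 i20 i21 i22 i23 i24 i25; omega)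
  rw [le_min_iff] at r2 r4 r6
  rw [le_min_iff] at r6
  rw [max_le_iff] at r5
  refine ⟨c, d, by omega, r2.1, by omega, by omega, r4.1, by omega, by omega, by omega, r6.1.1,
    by omega, by omega⟩

set_option maxHeartbeats 4000000 in
lemma regimeF (a : Fin 14 → ℕ) (l : ℕ) (h : Con a l)
    (h0 : a 0 = 0) (h5 : a 5 = 0) (h8 : a 8 = 0) : Dec a l := by
  obtain ⟨tot, q1a, q1b, q1c, q2a, q2b, q2c, q3a, q3b, q3c, q3d, q4a, q4b, q4c, q5a, q5b, q5c,
    q6a, q6b, q6c, q6d, q7a, q7b, q7c, q7d, q7e, q7f, q7g, q8a, q8b, q8c, q8d, q8e, q8f, q8g⟩ := h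
  obtain ⟨c24, c25, r1, r2, r3, r4, r5, r6, r7, r8, r9, r10, r11⟩ := regimeF_pair
    (a 1) (a 2) (a 3) (a 4) (a 6) (a 7) (a 9) (a 10) (a 11) (a 12) (a 13) l
    (by linarith)    (by linarith)    (by linarith)    (by linarith)    (by linarith)
    (by linarith)    (by linarith)    (by linarith)    (by linarith)    (by linarith)
    (by linarith)    (by linarith)    (by linarith)    (by linarith)    (by linarith)
    (by linarith)    (by linarith)    (by linarith)    (by linarith)    (by linarith)
    (by linarith)    (by linarith)    (by linarith)    (by linarith)    (by linarith)
    (by linarith)    (by linarith)    (by linarith)    (by linarith)    (by linarith)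
    (by linarith)
  have g1 : a 1 + a 11 + a 12 ≤ l := by linarith
  have g2 : a 3 + a 4 + a 11 + a 13 ≤ l := by linarith
  have g3 : a 3 + a 4 + a 7 + a 10 ≤ l := by linarith
  have g4 : a 2 + a 3 + a 7 + a 10 ≤ l := by linarith
  have g5 : a 4 + a 7 + a 9 + a 10 ≤ l := by linarith
  have g6 : a 1 + a 2 + a 6 + a 9 + a 10 ≤ l := by linarith
  have g7 : a 2 + a 6 + a 7 + a 9 + a 10 ≤ l := by linarith
  clear q1a q1b q1c q2a q2b q2c q3a q3b q3c q3d q4a q4b q4c q5a q5b q5c q6a q6b q6c q6d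
  clear q7a q7b q7c q7d q7e q7f q7g q8a q8b q8c q8d q8e q8f q8g
  obtain ⟨c4, e4⟩ := Nat.exists_eq_add_of_le r2
  obtain ⟨c5, e5⟩ := Nat.exists_eq_add_of_le r5
  obtain ⟨c2, e2⟩ := Nat.exists_eq_add_of_le r9
  obtain ⟨f, ef⟩ := Nat.exists_eq_add_of_le r7
  refine master a l f 0 c2 c4 c5 0 0 c24 c25 0 0 (a 2) 0 0 (a 9)
    (by omega) (by omega) (by omega) (by omega) (by omega) (by omega) (by omega) (by omega) (by omega) (by omega) (by omega) (by omega) (by omega) ?_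
  clear h0 h5 h8 tot r8 r10 g1 g2
  intro b3 b6 b7 b8 b9 b10 p3 p6 p7 p8 p9 p10
  cases b3 <;> cases b6 <;> cases b7 <;> cases b8 <;> cases b9 <;> cases b10 <;>
    simp only [if_true, if_false, Bool.false_eq_true, true_or, or_true, or_false,
      forall_true_left] at p3 p6 p9 p10 ⊢ <;> omega

set_option maxHeartbeats 4000000 in
lemma regimeG (a : Fin 14 → ℕ) (l : ℕ) (h : Con a l)
    (h2 : a 2 = 0) (h5 : a 5 = 0) (h8 : a 8 = 0) (h9 : a 9 = 0) : Dec a l := by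
  obtain ⟨tot, q1a, q1b, q1c, q2a, q2b, q2c, q3a, q3b, q3c, q3d, q4a, q4b, q4c, q5a, q5b, q5c,
    q6a, q6b, q6c, q6d, q7a, q7b, q7c, q7d, q7e, q7f, q7g, q8a, q8b, q8c, q8d, q8e, q8f, q8g⟩ := h
  have g1 : a 0 + a 1 + a 11 + a 12 ≤ l := by linarith
  have g2 : a 3 + a 4 + a 11 + a 13 ≤ l := by linarith
  have g3 : a 6 + a 7 + a 10 ≤ l := by linarith
  have g4 : a 3 + a 4 + a 7 + a 10 ≤ l := by linarith
  have g5 : a 0 + a 1 + a 6 + a 10 ≤ l := by linarith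
  have g6 : a 0 + a 1 + a 3 + a 4 + a 10 + a 11 + a 12 + a 13 ≤ 2 * l := by linarith
  have g7 : a 0 + a 1 + a 3 + a 4 + a 6 + a 7 + a 10 + a 11 ≤ 2 * l := by linarith
  clear q1a q1b q1c q2a q2b q2c q3a q3b q3c q3d q4a q4b q4c q5a q5b q5c q6a q6b q6c q6d
  clear q7a q7b q7c q7d q7e q7f q7g q8a q8b q8c q8d q8e q8f q8g
  obtain ⟨r, r1, r2, r3, r4, r5, r6⟩ : ∃ r, a 0 + a 1 + a 3 + a 4 + a 10 ≤ l + r ∧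
      a 0 + a 1 + a 3 + a 4 + a 11 ≤ l + r ∧ r ≤ a 0 + a 1 ∧ r ≤ a 3 + a 4 ∧
      r + a 11 + a 12 + a 13 ≤ l ∧ r + a 10 + a 6 + a 7 ≤ l :=
    ⟨max (a 0 + a 1 + a 3 + a 4 + a 10 - l) (a 0 + a 1 + a 3 + a 4 + a 11 - l),
      by omega, by omega, by omega, by omega, by omega, by omega⟩
  obtain ⟨c1, d1, c2, d2, e1, e2, e3⟩ : ∃ c1 d1 c2 d2, a 0 = c1 + d1 ∧ a 1 = c2 + d2 ∧
      d1 + d2 = r := ⟨a 0 - min r (a 0), min r (a 0), a 1 - (r - min r (a 0)), r - min r (a 0),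
        by omega, by omega, by omega⟩
  obtain ⟨c4, d4, c5, d5, e4, e5, e6⟩ : ∃ c1 d1 c2 d2, a 3 = c1 + d1 ∧ a 4 = c2 + d2 ∧
      d1 + d2 = r := ⟨a 3 - min r (a 3), min r (a 3), a 4 - (r - min r (a 3)), r - min r (a 3),
        by omega, by omega, by omega⟩
  obtain ⟨c14, c15, c24, c25, e7, e8, e9, e10⟩ : ∃ c14 c15 c24 c25, d1 = c14 + c15 ∧
      d2 = c24 + c25 ∧ d4 = c14 + c24 ∧ d5 = c15 + c25 :=
    ⟨min d1 d4, d1 - min d1 d4, d4 - min d1 d4, d5 - (d1 - min d1 d4),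
      by omega, by omega, by omega, by omega⟩
  refine master a l (l + r - (a 0 + a 1 + a 3 + a 4 + a 10)) c1 c2 c4 c5 c15 c14 c24 c25
    0 0 0 0 0 0
    (by omega) (by omega) (by omega) (by omega) (by omega) (by omega) (by omega) (by omega) (by omega) (by omega) (by omega) (by omega) (by omega) ?_
  clear h2 h5 h8 h9 tot
  intro b3 b6 b7 b8 b9 b10 p3 p6 p7 p8 p9 p10
  cases b3 <;> cases b6 <;> cases b7 <;> cases b8 <;> cases b9 <;> cases b10 <;>
    simp only [if_true, if_false, Bool.false_eq_true, true_or, or_true, or_false,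
      forall_true_left] at p3 p6 p9 p10 ⊢ <;> omega

set_option maxHeartbeats 2000000 in
/-- Removing one colour class from `{i, j, k}` preserves the inequalities. -/
lemma Con.move {a : Fin 14 → ℕ} {l : ℕ} (h : Con a (l + 1)) (hn : a 11 + a 12 + a 13 ≤ l)
    {i j k : Fin 14}
    (hS : (i = 0 ∧ j = 2 ∧ k = 4) ∨ (i = 1 ∧ j = 3 ∧ k = 5) ∨ (i = 0 ∧ j = 3 ∧ k = 9) ∨
      (i = 1 ∧ j = 4 ∧ k = 8))
    (hi : 0 < a i) (hj : 0 < a j) (hk : 0 < a k) :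
    Con (fun t => if t ∈ ({i, j, k} : Finset (Fin 14)) then a t - 1 else a t) l := by
  rcases hS with ⟨rfl, rfl, rfl⟩ | ⟨rfl, rfl, rfl⟩ | ⟨rfl, rfl, rfl⟩ | ⟨rfl, rfl, rfl⟩ <;>
  constructor <;>
  simp only [Finset.mem_insert, Finset.mem_singleton, Fin.reduceEq, or_false, or_true,
    if_true, if_false]
  · exact hn
  · have q := h.q1a; omega
  · have q := h.q1b; omega
  · have q := h.q1c; omega
  · have q := h.q2a; omega
  · have q := h.q2b; omega
  · have q := h.q2c; omega
  · have q := h.q3a; omega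
  · have q := h.q3b; omega
  · have q := h.q3c; omega
  · have q := h.q3d; omega
  · have q := h.q4a; omega
  · have q := h.q4b; omega
  · have q := h.q4c; omega
  · have q := h.q5a; omega
  · have q := h.q5b; omega
  · have q := h.q5c; omega
  · have q := h.q6a; omega
  · have q := h.q6b; omega
  · have q := h.q6c; omega
  · have q := h.q6d; omega
  · have q := h.q7a; omega
  · have q := h.q7b; omega
  · have q := h.q7c; omega
  · have q := h.q7d; omega
  · have q := h.q7e; omega
  · have q := h.q7f; omega
  · have q := h.q7g; omega
  · have q := h.q8a; omega
  · have q := h.q8b; omega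
  · have q := h.q8c; omega
  · have q := h.q8d; omega
  · have q := h.q8e; omega
  · have q := h.q8f; omega
  · have q := h.q8g; omega
  · exact hn
  · have q := h.q1a; omega
  · have q := h.q1b; omega
  · have q := h.q1c; omega
  · have q := h.q2a; omega
  · have q := h.q2b; omega
  · have q := h.q2c; omega
  · have q := h.q3a; omega
  · have q := h.q3b; omega
  · have q := h.q3c; omega
  · have q := h.q3d; omega
  · have q := h.q4a; omega
  · have q := h.q4b; omega
  · have q := h.q4c; omega
  · have q := h.q5a; omega
  · have q := h.q5b; omega
  · have q := h.q5c; omega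
  · have q := h.q6a; omega
  · have q := h.q6b; omega
  · have q := h.q6c; omega
  · have q := h.q6d; omega
  · have q := h.q7a; omega
  · have q := h.q7b; omega
  · have q := h.q7c; omega
  · have q := h.q7d; omega
  · have q := h.q7e; omega
  · have q := h.q7f; omega
  · have q := h.q7g; omega
  · have q := h.q8a; omega
  · have q := h.q8b; omega
  · have q := h.q8c; omega
  · have q := h.q8d; omega
  · have q := h.q8e; omega
  · have q := h.q8f; omega
  · have q := h.q8g; omega
  · exact hn
  · have q := h.q1a; omega
  · have q := h.q1b; omega
  · have q := h.q1c; omega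
  · have q := h.q2a; omega
  · have q := h.q2b; omega
  · have q := h.q2c; omega
  · have q := h.q3a; omega
  · have q := h.q3b; omega
  · have q := h.q3c; omega
  · have q := h.q3d; omega
  · have q := h.q4a; omega
  · have q := h.q4b; omega
  · have q := h.q4c; omega
  · have q := h.q5a; omega
  · have q := h.q5b; omega
  · have q := h.q5c; omega
  · have q := h.q6a; omega
  · have q := h.q6b; omega
  · have q := h.q6c; omega
  · have q := h.q6d; omega
  · have q := h.q7a; omega
  · have q := h.q7b; omega
  · have q := h.q7c; omega
  · have q := h.q7d; omega
  · have q := h.q7e; omega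
  · have q := h.q7f; omega
  · have q := h.q7g; omega
  · have q := h.q8a; omega
  · have q := h.q8b; omega
  · have q := h.q8c; omega
  · have q := h.q8d; omega
  · have q := h.q8e; omega
  · have q := h.q8f; omega
  · have q := h.q8g; omega
  · exact hn
  · have q := h.q1a; omega
  · have q := h.q1b; omega
  · have q := h.q1c; omega
  · have q := h.q2a; omega
  · have q := h.q2b; omega
  · have q := h.q2c; omega
  · have q := h.q3a; omega
  · have q := h.q3b; omega
  · have q := h.q3c; omega
  · have q := h.q3d; omega
  · have q := h.q4a; omega
  · have q := h.q4b; omega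
  · have q := h.q4c; omega
  · have q := h.q5a; omega
  · have q := h.q5b; omega
  · have q := h.q5c; omega
  · have q := h.q6a; omega
  · have q := h.q6b; omega
  · have q := h.q6c; omega
  · have q := h.q6d; omega
  · have q := h.q7a; omega
  · have q := h.q7b; omega
  · have q := h.q7c; omega
  · have q := h.q7d; omega
  · have q := h.q7e; omega
  · have q := h.q7f; omega
  · have q := h.q7g; omega
  · have q := h.q8a; omega
  · have q := h.q8b; omega
  · have q := h.q8c; omega
  · have q := h.q8d; omega
  · have q := h.q8e; omega
  · have q := h.q8f; omega
  · have q := h.q8g; omega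

/-- A symmetry of the auxiliary graph. -/
def permA : Equiv.Perm (Fin 14) where
  toFun := ![1, 0, 5, 4, 3, 2, 6, 7, 9, 8, 10, 11, 12, 13]
  invFun := ![1, 0, 5, 4, 3, 2, 6, 7, 9, 8, 10, 11, 12, 13]
  left_inv := by decide
  right_inv := by decide

/-- A symmetry of the auxiliary graph. -/
def permB : Equiv.Perm (Fin 14) where
  toFun := ![4, 3, 2, 1, 0, 5, 7, 6, 9, 8, 10, 11, 13, 12]
  invFun := ![4, 3, 2, 1, 0, 5, 7, 6, 9, 8, 10, 11, 13, 12]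
  left_inv := by decide
  right_inv := by decide

lemma permA_ok : ∀ i j, auxEdge i j = false → auxEdge j i = false →
    auxEdge (permA i) (permA j) = false := by decide

lemma Con.swap_permA {a : Fin 14 → ℕ} {l : ℕ} (h : Con a l) : Con (fun i => a (permA i)) l := by
  have e0 : permA 0 = 1 := rfl
  have e1 : permA 1 = 0 := rfl
  have e2 : permA 2 = 5 := rfl
  have e3 : permA 3 = 4 := rfl
  have e4 : permA 4 = 3 := rfl
  have e5 : permA 5 = 2 := rfl
  have e6 : permA 6 = 6 := rfl
  have e7 : permA 7 = 7 := rfl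
  have e8 : permA 8 = 9 := rfl
  have e9 : permA 9 = 8 := rfl
  have e10 : permA 10 = 10 := rfl
  have e11 : permA 11 = 11 := rfl
  have e12 : permA 12 = 12 := rfl
  have e13 : permA 13 = 13 := rfl
  constructor <;> simp only [e0, e1, e2, e3, e4, e5, e6, e7, e8, e9, e10, e11, e12, e13]
  · have q := h.tot; omega
  · have q := h.q2a; omega
  · have q := h.q2b; omega
  · have q := h.q2c; omega
  · have q := h.q1a; omega
  · have q := h.q1b; omega
  · have q := h.q1c; omega
  · have q := h.q6a; omega
  · have q := h.q6b; omega
  · have q := h.q6d; omega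
  · have q := h.q6c; omega
  · have q := h.q5a; omega
  · have q := h.q5b; omega
  · have q := h.q5c; omega
  · have q := h.q4a; omega
  · have q := h.q4b; omega
  · have q := h.q4c; omega
  · have q := h.q3a; omega
  · have q := h.q3b; omega
  · have q := h.q3d; omega
  · have q := h.q3c; omega
  · have q := h.q7a; omega
  · have q := h.q7c; omega
  · have q := h.q7b; omega
  · have q := h.q7g; omega
  · have q := h.q7f; omega
  · have q := h.q7e; omega
  · have q := h.q7d; omega
  · have q := h.q8a; omega
  · have q := h.q8c; omega
  · have q := h.q8b; omega
  · have q := h.q8g; omega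
  · have q := h.q8f; omega
  · have q := h.q8e; omega
  · have q := h.q8d; omega

lemma permB_ok : ∀ i j, auxEdge i j = false → auxEdge j i = false →
    auxEdge (permB i) (permB j) = false := by decide

lemma Con.swap_permB {a : Fin 14 → ℕ} {l : ℕ} (h : Con a l) : Con (fun i => a (permB i)) l := by
  have e0 : permB 0 = 4 := rfl
  have e1 : permB 1 = 3 := rfl
  have e2 : permB 2 = 2 := rfl
  have e3 : permB 3 = 1 := rfl
  have e4 : permB 4 = 0 := rfl
  have e5 : permB 5 = 5 := rfl
  have e6 : permB 6 = 7 := rfl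
  have e7 : permB 7 = 6 := rfl
  have e8 : permB 8 = 9 := rfl
  have e9 : permB 9 = 8 := rfl
  have e10 : permB 10 = 10 := rfl
  have e11 : permB 11 = 11 := rfl
  have e12 : permB 12 = 13 := rfl
  have e13 : permB 13 = 12 := rfl
  constructor <;> simp only [e0, e1, e2, e3, e4, e5, e6, e7, e8, e9, e10, e11, e12, e13]
  · have q := h.tot; omega
  · have q := h.q5a; omega
  · have q := h.q5b; omega
  · have q := h.q5c; omega
  · have q := h.q4a; omega
  · have q := h.q4b; omega
  · have q := h.q4c; omega
  · have q := h.q3b; omega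
  · have q := h.q3a; omega
  · have q := h.q3d; omega
  · have q := h.q3c; omega
  · have q := h.q2a; omega
  · have q := h.q2b; omega
  · have q := h.q2c; omega
  · have q := h.q1a; omega
  · have q := h.q1b; omega
  · have q := h.q1c; omega
  · have q := h.q6b; omega
  · have q := h.q6a; omega
  · have q := h.q6d; omega
  · have q := h.q6c; omega
  · have q := h.q8a; omega
  · have q := h.q8c; omega
  · have q := h.q8b; omega
  · have q := h.q8e; omega
  · have q := h.q8d; omega
  · have q := h.q8g; omega
  · have q := h.q8f; omega
  · have q := h.q7a; omega
  · have q := h.q7c; omega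
  · have q := h.q7b; omega
  · have q := h.q7e; omega
  · have q := h.q7d; omega
  · have q := h.q7g; omega
  · have q := h.q7f; omega

/-- The integer decomposition result. -/
lemma core (l : ℕ) : ∀ a : Fin 14 → ℕ, Con a l → Dec a l := by
  induction l with
  | zero =>
    intro a h
    exact regimeB a 0 h (by have := h.tot; omega)
  | succ l ih =>
    intro a h
    by_cases hn : a 11 + a 12 + a 13 = l + 1
    · exact regimeB a _ h hn
    have hn' : a 11 + a 12 + a 13 ≤ l := by have := h.tot; omega
    have mv : ∀ i j k : Fin 14,
        ((i = 0 ∧ j = 2 ∧ k = 4) ∨ (i = 1 ∧ j = 3 ∧ k = 5) ∨ (i = 0 ∧ j = 3 ∧ k = 9) ∨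
          (i = 1 ∧ j = 4 ∧ k = 8)) → Dec a (l + 1) ∨ (a i = 0 ∨ a j = 0 ∨ a k = 0) := by
      intro i j k hS
      by_cases hp : 0 < a i ∧ 0 < a j ∧ 0 < a k
      · left
        refine Dec.step {i, j, k} ?_ 1 (by omega) (ih _ (h.move hn' hS hp.1 hp.2.1 hp.2.2))
        rcases hS with ⟨rfl, rfl, rfl⟩ | ⟨rfl, rfl, rfl⟩ | ⟨rfl, rfl, rfl⟩ | ⟨rfl, rfl, rfl⟩ <;>
          decide
      · right
        omega
    rcases mv 0 2 4 (by simp) with h1 | h1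
    · exact h1
    rcases mv 1 3 5 (by simp) with h2 | h2
    · exact h2
    rcases mv 0 3 9 (by simp) with h3 | h3
    · exact h3
    rcases mv 1 4 8 (by simp) with h4 | h4
    · exact h4
    have cover : (a 0 = 0 ∧ a 1 = 0) ∨ (a 4 = 0 ∧ a 3 = 0) ∨
        (a 0 = 0 ∧ a 3 = 0 ∧ a 8 = 0) ∨ (a 1 = 0 ∧ a 4 = 0 ∧ a 9 = 0) ∨
        (a 0 = 0 ∧ a 4 = 0 ∧ a 5 = 0) ∨ (a 1 = 0 ∧ a 3 = 0 ∧ a 2 = 0) ∨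
        (a 0 = 0 ∧ a 5 = 0 ∧ a 8 = 0) ∨ (a 1 = 0 ∧ a 2 = 0 ∧ a 9 = 0) ∨
        (a 4 = 0 ∧ a 5 = 0 ∧ a 9 = 0) ∨ (a 3 = 0 ∧ a 2 = 0 ∧ a 8 = 0) ∨
        (a 2 = 0 ∧ a 5 = 0 ∧ a 8 = 0 ∧ a 9 = 0) := by
      clear ih mv h hn hn'
      rcases h1 with h1 | h1 | h1 <;> rcases h2 with h2 | h2 | h2 <;>
        rcases h3 with h3 | h3 | h3 <;> rcases h4 with h4 | h4 | h4 <;>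
        simp only [h1, h2, h3, h4, true_and, and_true, true_or, or_true]
    rcases cover with ⟨z1, z2⟩ | ⟨z1, z2⟩ | ⟨z1, z2, z3⟩ | ⟨z1, z2, z3⟩ | ⟨z1, z2, z3⟩ |
      ⟨z1, z2, z3⟩ | ⟨z1, z2, z3⟩ | ⟨z1, z2, z3⟩ | ⟨z1, z2, z3⟩ | ⟨z1, z2, z3⟩ | ⟨z1, z2, z3, z4⟩
    · exact regimeC a _ h z1 z2
    · exact Dec.perm permB permB_ok (regimeC _ _ h.swap_permB z1 z2)
    · exact regimeD a _ h z1 z2 z3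
    · exact Dec.perm permA permA_ok (regimeD _ _ h.swap_permA z1 z2 z3)
    · exact regimeE a _ h z1 z2 z3
    · exact Dec.perm permA permA_ok (regimeE _ _ h.swap_permA z1 z2 z3)
    · exact regimeF a _ h z1 z2 z3
    · exact Dec.perm permA permA_ok (regimeF _ _ h.swap_permA z1 z2 z3)
    · exact Dec.perm permB permB_ok (regimeF _ _ h.swap_permB z1 z2 z3)
    · exact Dec.perm permA permA_ok (Dec.perm permB permB_ok (regimeF _ _ h.swap_permA.swap_permB z1 z2 z3))
    · exact regimeG a _ h z1 z2 z3 z4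

/-- The edges of the refined gear graph: `6, 10` are the two halves of `v7`, and `7, 11` are
the two halves of `v8`. -/
def edge12 (i j : Fin 12) : Bool :=
  match i.val, j.val with
  | 0, 1 => true | 1, 2 => true | 2, 3 => true | 3, 4 => true | 4, 5 => true | 0, 5 => true
  | 6, 0 => true | 6, 1 => true | 6, 2 => true | 6, 5 => true
  | 7, 2 => true | 7, 3 => true | 7, 4 => true | 7, 5 => true | 7, 6 => true
  | 8, 0 => true | 8, 2 => true | 8, 3 => true | 8, 5 => true | 8, 6 => true | 8, 7 => true
  | 9, 1 => true | 9, 2 => true | 9, 4 => true | 9, 5 => true | 9, 6 => true | 9, 7 => true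
  | 10, 0 => true | 10, 1 => true | 10, 2 => true | 10, 5 => true
  | 10, 6 => true | 10, 8 => true | 10, 9 => true
  | 11, 2 => true | 11, 3 => true | 11, 4 => true | 11, 5 => true
  | 11, 7 => true | 11, 8 => true | 11, 9 => true
  | _, _ => false

/-- Symmetric adjacency of the refined gear graph. -/
def adj12 (i j : Fin 12) : Bool := edge12 i j || edge12 j i

/-- Forget the refinement. -/
def coarse : Fin 12 → Fin 10 := ![0, 1, 2, 3, 4, 5, 6, 7, 8, 9, 6, 7]

lemma gearH_adj : ∀ i j : Fin 12, coarse i ≠ coarse j → ¬ (coarse i = 6 ∧ coarse j = 7) →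
    ¬ (coarse i = 7 ∧ coarse j = 6) →
    (gearH.Adj (coarse i) (coarse j) ↔ adj12 i j = true) := by
  unfold gearH
  simp only [SimpleGraph.fromEdgeSet_adj, Set.mem_insert_iff, Set.mem_singleton_iff]
  decide

lemma gearH_adj67 : gearH.Adj 6 7 := by
  unfold gearH
  simp only [SimpleGraph.fromEdgeSet_adj, Set.mem_insert_iff, Set.mem_singleton_iff]
  decide

/-- The refined partition of the gear strip. -/
structure GearCls [DecidableEq V] (G : SimpleGraph V) (V2 X2 Y2 : Finset V) (cls : V → Fin 12) :
    Prop where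
  adj : ∀ u ∈ V2, ∀ v ∈ V2, u ≠ v → (G.Adj u v ↔ cls u = cls v ∨ adj12 (cls u) (cls v) = true)
  ne : ∀ i : Fin 12, i.val < 8 → ∃ v ∈ V2, cls v = i
  hX : ∀ v ∈ V2, (v ∈ X2 ↔ cls v = 0 ∨ cls v = 1)
  hY : ∀ v ∈ V2, (v ∈ Y2 ↔ cls v = 3 ∨ cls v = 4)
  h10 : (V2.filter fun v => cls v = 10).card ≤ (V2.filter fun v => cls v = 7).card
  h11 : (V2.filter fun v => cls v = 11).card ≤ (V2.filter fun v => cls v = 6).card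

/-- The structure of a skeletal pair with at least one edge. -/
lemma skel_pair [Fintype V] [DecidableEq V] (G : SimpleGraph V) (A B : Finset V)
    (hA : G.IsClique (↑A : Set V)) (hB : G.IsClique (↑B : Set V)) (hd : Disjoint A B)
    (hs : IsSkeletalPair G A B) (he : ∃ a ∈ A, ∃ b ∈ B, G.Adj a b) :
    ∃ A' B' : Finset V, A' ⊆ A ∧ B' ⊆ B ∧ A'.Nonempty ∧ B'.Nonempty ∧
      (∀ a ∈ A, ∀ b ∈ B, (G.Adj a b ↔ a ∈ A' ∧ b ∈ B')) ∧
      (B \ B').card ≤ A'.card ∧ (A \ A').card ≤ B'.card := by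
  have bdd : ∀ G' : SimpleGraph V,
      BddAbove {n | ∃ s : Finset V, (↑s : Set V) ⊆ ↑A ∪ ↑B ∧ G'.IsNClique n s} := by
    intro G'
    refine ⟨Fintype.card V, ?_⟩
    rintro n ⟨s, -, hs⟩
    rw [← hs.card_eq]
    exact Finset.card_le_univ s
  obtain ⟨Q, hQs, hQ⟩ : cliqueNumOn G (↑A ∪ ↑B) ∈
      {n | ∃ s : Finset V, (↑s : Set V) ⊆ ↑A ∪ ↑B ∧ G.IsNClique n s} := by
    apply Nat.sSup_mem _ (bdd G)
    exact ⟨A.card, A, Set.subset_union_left, hA, rfl⟩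
  have hAQ : A.card ≤ Q.card := by
    rw [hQ.card_eq]
    exact le_csSup (bdd G) ⟨A, Set.subset_union_left, hA, rfl⟩
  have hBQ : B.card ≤ Q.card := by
    rw [hQ.card_eq]
    exact le_csSup (bdd G) ⟨B, Set.subset_union_right, hB, rfl⟩
  have hmem : ∀ a ∈ A, ∀ b ∈ B, G.Adj a b → a ∈ Q ∧ b ∈ Q := by
    intro a ha b hb hab
    by_contra hcon
    have hlt := hs a ha b hb hab
    refine absurd hlt (not_lt.2 ?_)
    refine le_csSup (bdd _) ⟨Q, hQs, ?_, hQ.card_eq⟩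
    intro x hx y hy hxy
    rw [SimpleGraph.deleteEdges_adj]
    refine ⟨hQ.isClique hx hy hxy, ?_⟩
    intro hxy'
    rw [Set.mem_singleton_iff, Sym2.eq_iff] at hxy'
    apply hcon
    rcases hxy' with ⟨rfl, rfl⟩ | ⟨rfl, rfl⟩
    · exact ⟨hx, hy⟩
    · exact ⟨hy, hx⟩
  have hQu : Q = A ∩ Q ∪ B ∩ Q := by
    ext x
    simp only [Finset.mem_union, Finset.mem_inter]
    constructor
    · intro hx
      rcases hQs hx with h | h
      · exact Or.inl ⟨h, hx⟩
      · exact Or.inr ⟨h, hx⟩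
    · rintro (h | h) <;> exact h.2
  have hcard : Q.card ≤ (A ∩ Q).card + (B ∩ Q).card := by
    conv_lhs => rw [hQu]
    exact Finset.card_union_le _ _
  have h1 := Finset.card_sdiff_add_card_inter A Q
  have h2 := Finset.card_sdiff_add_card_inter B Q
  obtain ⟨a, ha, b, hb, hab⟩ := he
  have hab' := hmem a ha b hb hab
  refine ⟨A ∩ Q, B ∩ Q, Finset.inter_subset_left, Finset.inter_subset_left,
    ⟨a, Finset.mem_inter.2 ⟨ha, hab'.1⟩⟩, ⟨b, Finset.mem_inter.2 ⟨hb, hab'.2⟩⟩, ?_, ?_, ?_⟩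
  · intro a ha b hb
    simp only [Finset.mem_inter, ha, hb, true_and]
    refine ⟨hmem a ha b hb, fun h => hQ.isClique h.1 h.2 ?_⟩
    rintro rfl
    exact Finset.disjoint_left.1 hd ha hb
  · rw [Finset.sdiff_inter_self_left]
    omega
  · rw [Finset.sdiff_inter_self_left]
    omega

/-- Extracting the refined partition from a gear strip. -/
lemma exists_gearCls [Fintype V] [DecidableEq V] (G : SimpleGraph V)
    (V1 V2 X1 Y1 X2 Y2 : Finset V)
    (hsk : Skeletal G) (hj : IsGen2Join G V1 V2 X1 Y1 X2 Y2) (hstrip : IsGearStripOn G V2 X2 Y2) :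
    ∃ cls : V → Fin 12, GearCls G V2 X2 Y2 cls := by
  classical
  obtain ⟨Xd, M, f, hXd, hM, th, hX2, hY2⟩ := hstrip
  have hR : ∀ w : Fin 10, w ≠ 8 → w ≠ 9 → w ∈ ((↑Xd : Set (Fin 10))ᶜ) := by
    intro w h8 h9 hw
    have := hXd hw
    simp at this
    tauto
  have hMX : ∀ x y : Fin 10, s(x, y) ∈ M → (x = 6 ∧ y = 7) ∨ (x = 7 ∧ y = 6) := by
    intro x y h
    have := hM h
    rw [Set.mem_singleton_iff, Sym2.eq_iff] at this
    exact this
  have memX : ∀ v ∈ V2, (v ∈ X2 ↔ f v = 0 ∨ f v = 1) := by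
    intro v hv
    have : v ∈ (↑X2 : Set V) ↔ v ∈ {v | v ∈ V2 ∧ (f v = 0 ∨ f v = 1)} := by rw [hX2]
    simpa [hv] using this
  have memY : ∀ v ∈ V2, (v ∈ Y2 ↔ f v = 3 ∨ f v = 4) := by
    intro v hv
    have : v ∈ (↑Y2 : Set V) ↔ v ∈ {v | v ∈ V2 ∧ (f v = 3 ∨ f v = 4)} := by rw [hY2]
    simpa [hv] using this
  set A := V2.filter fun v => f v = 6 with hAdef
  set B := V2.filter fun v => f v = 7 with hBdef
  have cA : G.IsClique (↑A : Set V) := by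
    have := th.fibers_clique 6
    intro x hx y hy hxy
    simp only [hAdef, Finset.coe_filter, Set.mem_ofPred_eq] at hx hy
    exact this hx hy hxy
  have cB : G.IsClique (↑B : Set V) := by
    have := th.fibers_clique 7
    intro x hx y hy hxy
    simp only [hBdef, Finset.coe_filter, Set.mem_ofPred_eq] at hx hy
    exact this hx hy hxy
  have dAB : Disjoint A B := by
    rw [Finset.disjoint_left]
    intro x hx hy
    simp only [hAdef, hBdef, Finset.mem_filter] at hx hy
    rw [hx.2] at hy
    exact absurd hy.2 (by decide)
  have nA : A.Nonempty := by
    obtain ⟨v, hv, h⟩ := th.fibers_nonempty 6 (hR 6 (by decide) (by decide))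
    exact ⟨v, Finset.mem_filter.2 ⟨hv, h⟩⟩
  have nB : B.Nonempty := by
    obtain ⟨v, hv, h⟩ := th.fibers_nonempty 7 (hR 7 (by decide) (by decide))
    exact ⟨v, Finset.mem_filter.2 ⟨hv, h⟩⟩
  have split : ∃ A' B' : Finset V, A' ⊆ A ∧ B' ⊆ B ∧ A'.Nonempty ∧ B'.Nonempty ∧
      (∀ a ∈ A, ∀ b ∈ B, (G.Adj a b ↔ a ∈ A' ∧ b ∈ B')) ∧
      (B \ B').card ≤ A'.card ∧ (A \ A').card ≤ B'.card := by
    by_cases h67 : s((6 : Fin 10), 7) ∈ M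
    · obtain ⟨u, hu, v, hv, fu, fv, huv⟩ := th.semi_adj 6 (hR 6 (by decide) (by decide)) 7
        (hR 7 (by decide) (by decide)) h67
      obtain ⟨u', hu', v', hv', fu', fv', huv'⟩ := th.semi_nonadj 6
        (hR 6 (by decide) (by decide)) 7 (hR 7 (by decide) (by decide)) h67
      have uA : u ∈ A := Finset.mem_filter.2 ⟨hu, fu⟩
      have uA' : u' ∈ A := Finset.mem_filter.2 ⟨hu', fu'⟩
      have vB : v ∈ B := Finset.mem_filter.2 ⟨hv, fv⟩
      have vB' : v' ∈ B := Finset.mem_filter.2 ⟨hv', fv'⟩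
      have hcard : 3 ≤ A.card + B.card := by
        have p1 := nA.card_pos
        have p2 := nB.card_pos
        by_contra hlt
        have e1 : A.card = 1 := by omega
        have e2 : B.card = 1 := by omega
        have := Finset.card_le_one.1 e1.le u uA u' uA'
        have h2 := Finset.card_le_one.1 e2.le v vB v' vB'
        rw [this, h2] at huv
        exact huv' huv
      have hom : IsHomPair G A B := by
        refine ⟨Set.subset_univ _, Set.subset_univ _, cA, cB, nA, nB, dAB, hcard, ?_⟩
        intro w _ hwA hwB
        have hw : w ∈ V1 ∨ w ∈ V2 := by
          have : w ∈ V1 ∪ V2 := by rw [hj.unionV]; exact Finset.mem_univ _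
          exact Finset.mem_union.1 this
        rcases hw with hw | hw
        · have hno : ∀ a ∈ V2, (f a = 6 ∨ f a = 7) → ¬ G.Adj w a := by
            intro a ha hfa hadj
            rcases hj.cross w hw a ha hadj with h | h
            · have := (memX a ha).1 h.2
              rcases hfa with h' | h' <;> rw [h'] at this <;> revert this <;> decide
            · have := (memY a ha).1 h.2
              rcases hfa with h' | h' <;> rw [h'] at this <;> revert this <;> decide
          constructor
          · right
            intro a ha
            exact hno a (Finset.mem_filter.1 ha).1 (Or.inl (Finset.mem_filter.1 ha).2)
          · right
            intro a ha
            exact hno a (Finset.mem_filter.1 ha).1 (Or.inr (Finset.mem_filter.1 ha).2)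
        · have f6 : f w ≠ 6 := fun h => hwA (Finset.mem_filter.2 ⟨hw, h⟩)
          have f7 : f w ≠ 7 := fun h => hwB (Finset.mem_filter.2 ⟨hw, h⟩)
          have gen : ∀ t : Fin 10, (t = 6 ∨ t = 7) →
              (∀ a ∈ V2.filter fun v => f v = t, G.Adj w a) ∨
              (∀ a ∈ V2.filter fun v => f v = t, ¬ G.Adj w a) := by
            intro t ht
            have hne : f w ≠ t := by rcases ht with rfl | rfl <;> assumption
            by_cases hadj : gearH.Adj (f w) t
            · left
              intro a ha
              obtain ⟨ha2, hfa⟩ := Finset.mem_filter.1 ha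
              subst hfa
              refine th.adj_of_adj w hw a ha2 hne hadj ?_
              intro hm
              rcases hMX _ _ hm with h | h
              · exact f6 h.1
              · exact f7 h.1
            · right
              intro a ha
              obtain ⟨ha2, hfa⟩ := Finset.mem_filter.1 ha
              subst hfa
              exact th.nonadj_of_nonadj w hw a ha2 hne hadj
          exact ⟨gen 6 (Or.inl rfl), gen 7 (Or.inr rfl)⟩
      exact skel_pair G A B cA cB dAB (hsk A B hom) ⟨u, uA, v, vB, huv⟩
    · refine ⟨A, B, subset_rfl, subset_rfl, nA, nB, ?_, by simp, by simp⟩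
      intro a ha b hb
      refine ⟨fun _ => ⟨ha, hb⟩, fun _ => ?_⟩
      obtain ⟨ha, fa⟩ := Finset.mem_filter.1 ha
      obtain ⟨hb, fb⟩ := Finset.mem_filter.1 hb
      refine th.adj_of_adj a ha b hb ?_ ?_ ?_
      · rw [fa, fb]
        decide
      · rw [fa, fb]
        exact gearH_adj67
      · rw [fa, fb]
        exact h67
  obtain ⟨A', B', hA', hB', nA', nB', hadj', hc1, hc2⟩ := split
  let up : Fin 10 → Fin 12 := ![0, 1, 2, 3, 4, 5, 6, 7, 8, 9]
  let cls : V → Fin 12 := fun v =>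
    if f v = 6 then (if v ∈ A' then 6 else 10) else
    if f v = 7 then (if v ∈ B' then 7 else 11) else up (f v)
  have hup : ∀ w, coarse (up w) = w := by decide
  have hcoarse : ∀ v, coarse (cls v) = f v := by
    intro v
    simp only [cls]
    split_ifs with h1 h2 h3 h4
    · rw [h1]; decide
    · rw [h1]; decide
    · rw [h3]; decide
    · rw [h3]; decide
    · exact hup _
  have up6 : ∀ w : Fin 10, up w ≠ 10 ∧ up w ≠ 11 ∧ (up w = 6 → w = 6) ∧ (up w = 7 → w = 7) := by
    decide
  have c6 : (V2.filter fun v => cls v = 6) = A' := by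
    ext v
    simp only [Finset.mem_filter]
    constructor
    · rintro ⟨hv, h⟩
      have hf : f v = 6 := by
        have hf := hcoarse v
        rw [h] at hf
        exact hf.symm
      by_contra hn
      have : cls v = 10 := by
        simp only [cls]
        rw [if_pos hf, if_neg hn]
      rw [this] at h
      exact absurd h (by decide)
    · intro h
      obtain ⟨hv, hf⟩ := Finset.mem_filter.1 (hA' h)
      refine ⟨hv, ?_⟩
      simp only [cls]
      rw [if_pos hf, if_pos h]
  have c7 : (V2.filter fun v => cls v = 7) = B' := by
    ext v
    simp only [Finset.mem_filter]
    constructor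
    · rintro ⟨hv, h⟩
      have hf : f v = 7 := by
        have hf := hcoarse v
        rw [h] at hf
        exact hf.symm
      by_contra hn
      have : cls v = 11 := by
        simp only [cls]
        rw [hf, if_neg (by decide), if_pos rfl, if_neg hn]
      rw [this] at h
      exact absurd h (by decide)
    · intro h
      obtain ⟨hv, hf⟩ := Finset.mem_filter.1 (hB' h)
      refine ⟨hv, ?_⟩
      simp only [cls]
      rw [hf, if_neg (by decide), if_pos rfl, if_pos h]
  have c10 : (V2.filter fun v => cls v = 10) ⊆ A \ A' := by
    intro v hv
    obtain ⟨hv, h⟩ := Finset.mem_filter.1 hv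
    have hf : f v = 6 := by
      have hf := hcoarse v
      rw [h] at hf
      exact hf.symm
    rw [Finset.mem_sdiff]
    refine ⟨Finset.mem_filter.2 ⟨hv, hf⟩, fun hm => ?_⟩
    rw [← c6] at hm
    have := (Finset.mem_filter.1 hm).2
    rw [h] at this
    exact absurd this (by decide)
  have c11 : (V2.filter fun v => cls v = 11) ⊆ B \ B' := by
    intro v hv
    obtain ⟨hv, h⟩ := Finset.mem_filter.1 hv
    have hf : f v = 7 := by
      have hf := hcoarse v
      rw [h] at hf
      exact hf.symm
    rw [Finset.mem_sdiff]
    refine ⟨Finset.mem_filter.2 ⟨hv, hf⟩, fun hm => ?_⟩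
    rw [← c7] at hm
    have := (Finset.mem_filter.1 hm).2
    rw [h] at this
    exact absurd this (by decide)
  have mem6 : ∀ v ∈ V2, (v ∈ A' ↔ cls v = 6) := by
    intro v hv
    rw [← c6, Finset.mem_filter]
    simp [hv]
  have mem7 : ∀ v ∈ V2, (v ∈ B' ↔ cls v = 7) := by
    intro v hv
    rw [← c7, Finset.mem_filter]
    simp [hv]
  have d67 : ∀ i j : Fin 12, coarse i = 6 → coarse j = 7 →
      ((i = 6 ∧ j = 7) ↔ (i = j ∨ adj12 i j = true)) := by decide
  have d76 : ∀ i j : Fin 12, coarse i = 7 → coarse j = 6 →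
      ((j = 6 ∧ i = 7) ↔ (i = j ∨ adj12 i j = true)) := by decide
  have dsame : ∀ i j : Fin 12, coarse i = coarse j → (i = j ∨ adj12 i j = true) := by decide
  refine ⟨cls, ?_, ?_, ?_, ?_, ?_, ?_⟩
  · intro u hu v hv huv
    by_cases hf : f u = f v
    · have h1 : G.Adj u v := th.fibers_clique (f v) ⟨hu, hf⟩ ⟨hv, rfl⟩ huv
      exact ⟨fun _ => dsame _ _ (by rw [hcoarse, hcoarse, hf]), fun _ => h1⟩
    by_cases h67 : f u = 6 ∧ f v = 7
    · rw [hadj' u (Finset.mem_filter.2 ⟨hu, h67.1⟩) v (Finset.mem_filter.2 ⟨hv, h67.2⟩),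
        mem6 u hu, mem7 v hv]
      exact d67 _ _ (by rw [hcoarse, h67.1]) (by rw [hcoarse, h67.2])
    by_cases h76 : f u = 7 ∧ f v = 6
    · rw [G.adj_comm, hadj' v (Finset.mem_filter.2 ⟨hv, h76.2⟩) u
        (Finset.mem_filter.2 ⟨hu, h76.1⟩), mem6 v hv, mem7 u hu]
      exact d76 _ _ (by rw [hcoarse, h76.1]) (by rw [hcoarse, h76.2])
    have hg := gearH_adj (cls u) (cls v) (by rw [hcoarse, hcoarse]; exact hf)
      (by rw [hcoarse, hcoarse]; exact h67) (by rw [hcoarse, hcoarse]; exact h76)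
    rw [hcoarse, hcoarse] at hg
    have hne : cls u ≠ cls v := by
      intro h
      apply hf
      rw [← hcoarse u, ← hcoarse v, h]
    simp only [hne, false_or]
    rw [← hg]
    constructor
    · intro h
      by_contra hn
      exact th.nonadj_of_nonadj u hu v hv hf hn h
    · intro h
      refine th.adj_of_adj u hu v hv hf h ?_
      intro hm
      rcases hMX _ _ hm with h | h
      · exact h67 h
      · exact h76 h
  · intro i hi
    by_cases h6 : i = 6
    · obtain ⟨v, hv⟩ := nA'
      rw [← c6] at hv
      exact ⟨v, (Finset.mem_filter.1 hv).1, by rw [h6]; exact (Finset.mem_filter.1 hv).2⟩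
    by_cases h7 : i = 7
    · obtain ⟨v, hv⟩ := nB'
      rw [← c7] at hv
      exact ⟨v, (Finset.mem_filter.1 hv).1, by rw [h7]; exact (Finset.mem_filter.1 hv).2⟩
    have dd : ∀ i : Fin 12, i.val < 8 → i ≠ 6 → i ≠ 7 → coarse i ≠ 8 ∧ coarse i ≠ 9 ∧
      coarse i ≠ 6 ∧ coarse i ≠ 7 ∧ up (coarse i) = i := by decide
    obtain ⟨d1, d2, d3, d4, d5⟩ := dd i hi h6 h7
    obtain ⟨v, hv, h⟩ := th.fibers_nonempty (coarse i) (hR _ d1 d2)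
    refine ⟨v, hv, ?_⟩
    simp only [cls]
    rw [h, if_neg d3, if_neg d4, d5]
  · intro v hv
    rw [memX v hv, ← hcoarse v]
    generalize cls v = i
    revert i
    decide
  · intro v hv
    rw [memY v hv, ← hcoarse v]
    generalize cls v = i
    revert i
    decide
  · rw [c7]
    exact (Finset.card_le_card c10).trans hc2
  · rw [c6]
    exact (Finset.card_le_card c11).trans hc1

/-- Using the local bound at a vertex. -/
lemma extract [Fintype V] [DecidableEq V] (G : SimpleGraph V) (V2 X1 Y1 : Finset V) (l : ℕ)
    (hl : gammaLJ G V2 X1 Y1 ≤ l) (v : V) (hv : v ∈ V2) (N Q : Finset V)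
    (hN : ∀ u ∈ N, u = v ∨ G.Adj v u) (hQ : G.IsClique (↑Q : Set V)) (hvQ : v ∈ Q)
    (hQs : Q ⊆ V2 ∪ X1 ∪ Y1)
    (hQ' : ¬((∃ x ∈ Q, x ∈ X1 ∧ x ∉ Y1) ∧ ∃ y ∈ Q, y ∈ Y1 ∧ y ∉ X1)) :
    N.card + Q.card ≤ 2 * l := by
  classical
  have h1 : (degree' G v + 1 + omegaJ G V2 X1 Y1 v + 1) / 2 ≤ l := by
    refine le_trans ?_ hl
    exact Finset.le_sup (f := fun v => (degree' G v + 1 + omegaJ G V2 X1 Y1 v + 1) / 2)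
      (Finset.mem_union_left _ (Finset.mem_union_left _ hv))
  have h2 : Q.card ≤ omegaJ G V2 X1 Y1 v := by
    refine le_csSup ?_ ⟨Q, ⟨hQ, rfl⟩, hvQ, hQs, hQ'⟩
    refine ⟨Fintype.card V, ?_⟩
    rintro n ⟨s, hs, -⟩
    rw [← hs.card_eq]
    exact Finset.card_le_univ s
  have h3 : N.card ≤ degree' G v + 1 := by
    have e : degree' G v = (G.neighborFinset v).card := by
      unfold degree'
      rw [← Set.ncard_coe_finset, SimpleGraph.coe_neighborFinset]
    have : N ⊆ insert v (G.neighborFinset v) := by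
      intro u hu
      rw [Finset.mem_insert, SimpleGraph.mem_neighborFinset]
      exact hN u hu
    rw [e]
    exact (Finset.card_le_card this).trans (Finset.card_insert_le _ _)
  omega

/-- The number of vertices in a class. -/
def clsCard [DecidableEq V] (V2 : Finset V) (cls : V → Fin 12) (i : Fin 12) : ℕ :=
  (V2.filter fun v => cls v = i).card

lemma card_cls [DecidableEq V] (V2 : Finset V) (cls : V → Fin 12) (S : Finset (Fin 12)) :
    (V2.filter fun v => cls v ∈ S).card = ∑ i ∈ S, clsCard V2 cls i := by
  unfold clsCard
  rw [← Finset.card_biUnion]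
  · congr 1
    ext v
    simp only [Finset.mem_filter, Finset.mem_biUnion]
    constructor
    · rintro ⟨h1, h2⟩
      exact ⟨_, h2, h1, rfl⟩
    · rintro ⟨i, h2, h1, rfl⟩
      exact ⟨h1, h2⟩
  · intro i _ j _ hij
    refine Finset.disjoint_left.2 ?_
    intro v h1 h2
    exact hij ((Finset.mem_filter.1 h1).2.symm.trans (Finset.mem_filter.1 h2).2)

/-- Vertices of `V2` in the classes of `S`, together with one of `∅`, `X1`, `Y1`. -/
def glue [DecidableEq V] (V2 X1 Y1 : Finset V) (cls : V → Fin 12) (S : Finset (Fin 12))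
    (t : Fin 3) : Finset V :=
  (V2.filter fun v => cls v ∈ S) ∪ (![∅, X1, Y1] t)

lemma extract_cls [Fintype V] [DecidableEq V] (G : SimpleGraph V)
    (V1 V2 X1 Y1 X2 Y2 : Finset V) (hj : IsGen2Join G V1 V2 X1 Y1 X2 Y2)
    (cls : V → Fin 12) (hc : GearCls G V2 X2 Y2 cls) (l : ℕ)
    (hl : gammaLJ G V2 X1 Y1 ≤ l) (i : Fin 12) (S Q : Finset (Fin 12)) (t u : Fin 3)
    (hi : i.val < 8)
    (hS : ∀ j ∈ S, i = j ∨ adj12 i j = true)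
    (hQ : i ∈ Q ∧ ∀ j ∈ Q, ∀ k ∈ Q, j = k ∨ adj12 j k = true)
    (ht : (t = 1 → i = 0 ∨ i = 1) ∧ (t = 2 → i = 3 ∨ i = 4))
    (hu : (u = 1 → ∀ j ∈ Q, j = 0 ∨ j = 1) ∧ (u = 2 → ∀ j ∈ Q, j = 3 ∨ j = 4)) :
    ((∑ j ∈ S, clsCard V2 cls j) + ![0, X1.card, Y1.card] t) +
      ((∑ j ∈ Q, clsCard V2 cls j) + ![0, X1.card, Y1.card] u) ≤ 2 * l := by
  have hdis : ∀ v, v ∈ V1 → v ∈ V2 → False := fun v h1 h2 => Finset.disjoint_left.1 hj.disjV h1 h2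
  have cardglue : ∀ (S : Finset (Fin 12)) (t : Fin 3),
      (glue V2 X1 Y1 cls S t).card = (∑ j ∈ S, clsCard V2 cls j) + ![0, X1.card, Y1.card] t := by
    intro S t
    unfold glue
    rw [Finset.card_union_of_disjoint, card_cls]
    · congr 1
      fin_cases t <;> simp
    · rw [Finset.disjoint_left]
      intro v h1 h2
      refine hdis v ?_ (Finset.mem_filter.1 h1).1
      fin_cases t
      · simp at h2
      · exact hj.subX1 h2
      · exact hj.subY1 h2
  have memglue : ∀ (S : Finset (Fin 12)) (t : Fin 3) (v : V), v ∈ glue V2 X1 Y1 cls S t →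
      (v ∈ V2 ∧ cls v ∈ S) ∨ (t = 1 ∧ v ∈ X1) ∨ (t = 2 ∧ v ∈ Y1) := by
    intro S t v hv
    unfold glue at hv
    rcases Finset.mem_union.1 hv with h | h
    · exact Or.inl (Finset.mem_filter.1 h)
    · fin_cases t
      · simp at h
      · exact Or.inr (Or.inl ⟨rfl, h⟩)
      · exact Or.inr (Or.inr ⟨rfl, h⟩)
  have adjX : ∀ x ∈ X1, ∀ v ∈ V2, (cls v = 0 ∨ cls v = 1) → G.Adj v x := by
    intro x hx v hv h
    refine hj.cliqueX (Or.inr ((hc.hX v hv).2 h)) (Or.inl hx) ?_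
    rintro rfl
    exact hdis v (hj.subX1 hx) hv
  have adjY : ∀ x ∈ Y1, ∀ v ∈ V2, (cls v = 3 ∨ cls v = 4) → G.Adj v x := by
    intro x hx v hv h
    refine hj.cliqueY (Or.inr ((hc.hY v hv).2 h)) (Or.inl hx) ?_
    rintro rfl
    exact hdis v (hj.subY1 hx) hv
  obtain ⟨v, hv, rfl⟩ := hc.ne i hi
  rw [← cardglue, ← cardglue]
  refine extract G V2 X1 Y1 l hl v hv _ _ ?_ ?_ ?_ ?_ ?_
  · intro w hw
    rcases memglue _ _ _ hw with ⟨h1, h2⟩ | ⟨h1, h2⟩ | ⟨h1, h2⟩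
    · by_cases e : w = v
      · exact Or.inl e
      · exact Or.inr ((hc.adj v hv w h1 (Ne.symm e)).2 (hS _ h2))
    · exact Or.inr (adjX w h2 v hv (ht.1 h1))
    · exact Or.inr (adjY w h2 v hv (ht.2 h1))
  · intro x hx y hy hxy
    rcases memglue _ _ _ hx with ⟨h1, h2⟩ | ⟨h1, h2⟩ | ⟨h1, h2⟩ <;>
    rcases memglue _ _ _ hy with ⟨k1, k2⟩ | ⟨k1, k2⟩ | ⟨k1, k2⟩
    · exact (hc.adj x h1 y k1 hxy).2 (hQ.2 _ h2 _ k2)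
    · exact adjX y k2 x h1 (hu.1 k1 _ h2)
    · exact adjY y k2 x h1 (hu.2 k1 _ h2)
    · exact (adjX x h2 y k1 (hu.1 h1 _ k2)).symm
    · exact hj.cliqueX (Or.inl h2) (Or.inl k2) hxy
    · rw [h1] at k1
      exact absurd k1 (by decide)
    · exact (adjY x h2 y k1 (hu.2 h1 _ k2)).symm
    · rw [h1] at k1
      exact absurd k1 (by decide)
    · exact hj.cliqueY (Or.inl h2) (Or.inl k2) hxy
  · exact Finset.mem_union_left _ (Finset.mem_filter.2 ⟨hv, hQ.1⟩)
  · intro w hw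
    rcases memglue _ _ _ hw with ⟨h1, h2⟩ | ⟨h1, h2⟩ | ⟨h1, h2⟩
    · exact Finset.mem_union_left _ (Finset.mem_union_left _ h1)
    · exact Finset.mem_union_left _ (Finset.mem_union_right _ h2)
    · exact Finset.mem_union_right _ h2
  · rintro ⟨⟨x, hx, hx1, hx2⟩, y, hy, hy1, hy2⟩
    rcases memglue _ _ _ hx with ⟨h1, h2⟩ | ⟨h1, h2⟩ | ⟨h1, h2⟩
    · exact hdis x (hj.subX1 hx1) h1
    · rcases memglue _ _ _ hy with ⟨k1, k2⟩ | ⟨k1, k2⟩ | ⟨k1, k2⟩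
      · exact hdis y (hj.subY1 hy1) k1
      · exact hy2 k2
      · rw [h1] at k1
        exact absurd k1 (by decide)
    · exact hx2 h2

/-- The demands of the auxiliary graph. -/
def demand (n : Fin 12 → ℕ) (k x y : ℕ) : Fin 14 → ℕ :=
  ![n 0, n 1, n 2, n 3, n 4, n 5, n 6 - n 11, n 7 - n 10, n 8, n 9, n 10 + n 11, k, x, y]

set_option maxHeartbeats 2000000 in
lemma con_of_gear [Fintype V] [DecidableEq V] (G : SimpleGraph V)
    (V1 V2 X1 Y1 X2 Y2 : Finset V) (hj : IsGen2Join G V1 V2 X1 Y1 X2 Y2)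
    (cls : V → Fin 12) (hc : GearCls G V2 X2 Y2 cls) (l : ℕ)
    (hl : gammaLJ G V2 X1 Y1 ≤ l) (k x y : ℕ) (hX : X1.card = k + x) (hY : Y1.card = k + y)
    (htot : k + x + y ≤ l) : Con (demand (clsCard V2 cls) k x y) l := by
  have ext := extract_cls G V1 V2 X1 Y1 X2 Y2 hj cls hc l hl
  have h10 : clsCard V2 cls 10 ≤ clsCard V2 cls 7 := hc.h10
  have h11 : clsCard V2 cls 11 ≤ clsCard V2 cls 6 := hc.h11
  rw [hX, hY] at ext
  generalize clsCard V2 cls = n at *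
  have e0 : demand n k x y 0 = n 0 := rfl
  have e1 : demand n k x y 1 = n 1 := rfl
  have e2 : demand n k x y 2 = n 2 := rfl
  have e3 : demand n k x y 3 = n 3 := rfl
  have e4 : demand n k x y 4 = n 4 := rfl
  have e5 : demand n k x y 5 = n 5 := rfl
  have e6 : demand n k x y 6 = n 6 - n 11 := rfl
  have e7 : demand n k x y 7 = n 7 - n 10 := rfl
  have e8 : demand n k x y 8 = n 8 := rfl
  have e9 : demand n k x y 9 = n 9 := rfl
  have e10 : demand n k x y 10 = n 10 + n 11 := rfl
  have e11 : demand n k x y 11 = k := rfl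
  have e12 : demand n k x y 12 = x := rfl
  have e13 : demand n k x y 13 = y := rfl
  constructor <;> simp only [e0, e1, e2, e3, e4, e5, e6, e7, e8, e9, e10, e11, e12, e13]
  · exact htot
  · have q := ext 0 {0, 1, 5, 6, 8, 10} {0, 1} 1 1 (by decide) (by decide) (by decide) (by decide) (by decide)
    simp at q
    omega
  · have q := ext 0 {0, 1, 5, 6, 8, 10} {0, 1, 6, 10} 1 0 (by decide) (by decide) (by decide) (by decide) (by decide)
    simp at q
    omega
  · have q := ext 0 {0, 1, 5, 6, 8, 10} {0, 5, 6, 8, 10} 1 0 (by decide) (by decide) (by decide) (by decide) (by decide)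
    simp at q
    omega
  · have q := ext 1 {0, 1, 2, 6, 9, 10} {0, 1} 1 1 (by decide) (by decide) (by decide) (by decide) (by decide)
    simp at q
    omega
  · have q := ext 1 {0, 1, 2, 6, 9, 10} {0, 1, 6, 10} 1 0 (by decide) (by decide) (by decide) (by decide) (by decide)
    simp at q
    omega
  · have q := ext 1 {0, 1, 2, 6, 9, 10} {1, 2, 6, 9, 10} 1 0 (by decide) (by decide) (by decide) (by decide) (by decide)
    simp at q
    omega
  · have q := ext 2 {1, 2, 3, 6, 7, 8, 9, 10, 11} {1, 2, 6, 9, 10} 0 0 (by decide) (by decide) (by decide) (by decide) (by decide)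
    simp at q
    omega
  · have q := ext 2 {1, 2, 3, 6, 7, 8, 9, 10, 11} {2, 3, 7, 8, 11} 0 0 (by decide) (by decide) (by decide) (by decide) (by decide)
    simp at q
    omega
  · have q := ext 2 {1, 2, 3, 6, 7, 8, 9, 10, 11} {2, 6, 7, 8} 0 0 (by decide) (by decide) (by decide) (by decide) (by decide)
    simp at q
    omega
  · have q := ext 2 {1, 2, 3, 6, 7, 8, 9, 10, 11} {2, 6, 7, 9} 0 0 (by decide) (by decide) (by decide) (by decide) (by decide)
    simp at q
    omega
  · have q := ext 3 {2, 3, 4, 7, 8, 11} {3, 4} 2 2 (by decide) (by decide) (by decide) (by decide) (by decide)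
    simp at q
    omega
  · have q := ext 3 {2, 3, 4, 7, 8, 11} {3, 4, 7, 11} 2 0 (by decide) (by decide) (by decide) (by decide) (by decide)
    simp at q
    omega
  · have q := ext 3 {2, 3, 4, 7, 8, 11} {2, 3, 7, 8, 11} 2 0 (by decide) (by decide) (by decide) (by decide) (by decide)
    simp at q
    omega
  · have q := ext 4 {3, 4, 5, 7, 9, 11} {3, 4} 2 2 (by decide) (by decide) (by decide) (by decide) (by decide)
    simp at q
    omega
  · have q := ext 4 {3, 4, 5, 7, 9, 11} {3, 4, 7, 11} 2 0 (by decide) (by decide) (by decide) (by decide) (by decide)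
    simp at q
    omega
  · have q := ext 4 {3, 4, 5, 7, 9, 11} {4, 5, 7, 9, 11} 2 0 (by decide) (by decide) (by decide) (by decide) (by decide)
    simp at q
    omega
  · have q := ext 5 {0, 4, 5, 6, 7, 8, 9, 10, 11} {0, 5, 6, 8, 10} 0 0 (by decide) (by decide) (by decide) (by decide) (by decide)
    simp at q
    omega
  · have q := ext 5 {0, 4, 5, 6, 7, 8, 9, 10, 11} {4, 5, 7, 9, 11} 0 0 (by decide) (by decide) (by decide) (by decide) (by decide)
    simp at q
    omega
  · have q := ext 5 {0, 4, 5, 6, 7, 8, 9, 10, 11} {5, 6, 7, 8} 0 0 (by decide) (by decide) (by decide) (by decide) (by decide)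
    simp at q
    omega
  · have q := ext 5 {0, 4, 5, 6, 7, 8, 9, 10, 11} {5, 6, 7, 9} 0 0 (by decide) (by decide) (by decide) (by decide) (by decide)
    simp at q
    omega
  · have q := ext 6 {0, 1, 2, 5, 6, 7, 8, 9, 10} {0, 1, 6, 10} 0 0 (by decide) (by decide) (by decide) (by decide) (by decide)
    simp at q
    omega
  · have q := ext 6 {0, 1, 2, 5, 6, 7, 8, 9, 10} {0, 5, 6, 8, 10} 0 0 (by decide) (by decide) (by decide) (by decide) (by decide)
    simp at q
    omega
  · have q := ext 6 {0, 1, 2, 5, 6, 7, 8, 9, 10} {1, 2, 6, 9, 10} 0 0 (by decide) (by decide) (by decide) (by decide) (by decide)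
    simp at q
    omega
  · have q := ext 6 {0, 1, 2, 5, 6, 7, 8, 9, 10} {2, 6, 7, 8} 0 0 (by decide) (by decide) (by decide) (by decide) (by decide)
    simp at q
    omega
  · have q := ext 6 {0, 1, 2, 5, 6, 7, 8, 9, 10} {2, 6, 7, 9} 0 0 (by decide) (by decide) (by decide) (by decide) (by decide)
    simp at q
    omega
  · have q := ext 6 {0, 1, 2, 5, 6, 7, 8, 9, 10} {5, 6, 7, 8} 0 0 (by decide) (by decide) (by decide) (by decide) (by decide)
    simp at q
    omega
  · have q := ext 6 {0, 1, 2, 5, 6, 7, 8, 9, 10} {5, 6, 7, 9} 0 0 (by decide) (by decide) (by decide) (by decide) (by decide)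
    simp at q
    omega
  · have q := ext 7 {2, 3, 4, 5, 6, 7, 8, 9, 11} {3, 4, 7, 11} 0 0 (by decide) (by decide) (by decide) (by decide) (by decide)
    simp at q
    omega
  · have q := ext 7 {2, 3, 4, 5, 6, 7, 8, 9, 11} {2, 3, 7, 8, 11} 0 0 (by decide) (by decide) (by decide) (by decide) (by decide)
    simp at q
    omega
  · have q := ext 7 {2, 3, 4, 5, 6, 7, 8, 9, 11} {4, 5, 7, 9, 11} 0 0 (by decide) (by decide) (by decide) (by decide) (by decide)
    simp at q
    omega
  · have q := ext 7 {2, 3, 4, 5, 6, 7, 8, 9, 11} {2, 6, 7, 8} 0 0 (by decide) (by decide) (by decide) (by decide) (by decide)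
    simp at q
    omega
  · have q := ext 7 {2, 3, 4, 5, 6, 7, 8, 9, 11} {2, 6, 7, 9} 0 0 (by decide) (by decide) (by decide) (by decide) (by decide)
    simp at q
    omega
  · have q := ext 7 {2, 3, 4, 5, 6, 7, 8, 9, 11} {5, 6, 7, 8} 0 0 (by decide) (by decide) (by decide) (by decide) (by decide)
    simp at q
    omega
  · have q := ext 7 {2, 3, 4, 5, 6, 7, 8, 9, 11} {5, 6, 7, 9} 0 0 (by decide) (by decide) (by decide) (by decide) (by decide)
    simp at q
    omega

lemma exists_inj {α β : Type*} [DecidableEq α] [Inhabited β] (s : Finset α) (t : Finset β)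
    (h : s.card ≤ t.card) : ∃ f : α → β, (∀ a ∈ s, f a ∈ t) ∧
      ∀ a ∈ s, ∀ b ∈ s, f a = f b → a = b := by
  classical
  obtain ⟨t', ht', hc⟩ := Finset.exists_subset_card_eq h
  let e : s ≃ t' := Finset.equivOfCardEq hc.symm
  refine ⟨fun a => if ha : a ∈ s then (e ⟨a, ha⟩ : β) else default, ?_, ?_⟩
  · intro a ha
    simp only [ha, dite_true]
    exact ht' (e ⟨a, ha⟩).2
  · intro a ha b hb hab
    simp only [ha, hb, dite_true] at hab
    have := e.injective (Subtype.ext hab)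
    exact congrArg Subtype.val this

/-- Reindex the stable sets so as to agree with the given colour sets. -/
lemma reindex_sets {l : ℕ} [Inhabited (Fin l)] {a : Fin 14 → ℕ} (h : Dec a l)
    (Kc Xc Yc : Finset (Fin l)) (hKX : Disjoint Kc Xc) (hKY : Disjoint Kc Yc)
    (hXY : Disjoint Xc Yc) (hK : Kc.card = a 11) (hX : Xc.card = a 12) (hY : Yc.card = a 13) :
    ∃ F : Fin l → Finset (Fin 14), (∀ j, Stab (F j)) ∧
      (∀ i, a i ≤ (Finset.univ.filter fun j => i ∈ F j).card) ∧
      (∀ c ∈ Kc, 11 ∈ F c) ∧ (∀ c ∈ Xc, 12 ∈ F c) ∧ (∀ c ∈ Yc, 13 ∈ F c) := by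
  classical
  obtain ⟨F, hF, hc⟩ := h
  obtain ⟨fk, fk1, fk2⟩ := exists_inj Kc (Finset.univ.filter fun j => 11 ∈ F j)
    (by rw [hK]; exact hc 11)
  obtain ⟨fx, fx1, fx2⟩ := exists_inj Xc (Finset.univ.filter fun j => 12 ∈ F j)
    (by rw [hX]; exact hc 12)
  obtain ⟨fy, fy1, fy2⟩ := exists_inj Yc (Finset.univ.filter fun j => 13 ∈ F j)
    (by rw [hY]; exact hc 13)
  simp only [Finset.mem_filter, Finset.mem_univ, true_and] at fk1 fx1 fy1
  have nKX : ∀ j, 11 ∈ F j → 12 ∈ F j → False := fun j h1 h2 =>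
    absurd (hF j _ h1 _ h2) (by decide)
  have nKY : ∀ j, 11 ∈ F j → 13 ∈ F j → False := fun j h1 h2 =>
    absurd (hF j _ h1 _ h2) (by decide)
  have nXY : ∀ j, 12 ∈ F j → 13 ∈ F j → False := fun j h1 h2 =>
    absurd (hF j _ h1 _ h2) (by decide)
  let g : Fin l → Fin l := fun c => if c ∈ Kc then fk c else if c ∈ Xc then fx c else fy c
  have gK : ∀ c ∈ Kc, g c = fk c := fun c h => if_pos h
  have gX : ∀ c ∈ Xc, g c = fx c := by
    intro c h
    have : c ∉ Kc := fun h' => Finset.disjoint_left.1 hKX h' h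
    simp only [g, this, h, if_true, if_false]
  have gY : ∀ c ∈ Yc, g c = fy c := by
    intro c h
    have h1 : c ∉ Kc := fun h' => Finset.disjoint_left.1 hKY h' h
    have h2 : c ∉ Xc := fun h' => Finset.disjoint_left.1 hXY h' h
    simp only [g, h1, h2, if_false]
  have ginj : Set.InjOn g (↑(Kc ∪ Xc ∪ Yc) : Set (Fin l)) := by
    intro c hc1 d hd1 hcd
    simp only [Finset.coe_union, Set.mem_union, Finset.mem_coe] at hc1 hd1
    rcases hc1 with (h1 | h1) | h1 <;> rcases hd1 with (h2 | h2) | h2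
    · rw [gK c h1, gK d h2] at hcd
      exact fk2 c h1 d h2 hcd
    · rw [gK c h1, gX d h2] at hcd
      have := fk1 c h1
      rw [hcd] at this
      exact (nKX _ this (fx1 d h2)).elim
    · rw [gK c h1, gY d h2] at hcd
      have := fk1 c h1
      rw [hcd] at this
      exact (nKY _ this (fy1 d h2)).elim
    · rw [gX c h1, gK d h2] at hcd
      have := fx1 c h1
      rw [hcd] at this
      exact (nKX _ (fk1 d h2) this).elim
    · rw [gX c h1, gX d h2] at hcd
      exact fx2 c h1 d h2 hcd
    · rw [gX c h1, gY d h2] at hcd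
      have := fx1 c h1
      rw [hcd] at this
      exact (nXY _ this (fy1 d h2)).elim
    · rw [gY c h1, gK d h2] at hcd
      have := fy1 c h1
      rw [hcd] at this
      exact (nKY _ (fk1 d h2) this).elim
    · rw [gY c h1, gX d h2] at hcd
      have := fy1 c h1
      rw [hcd] at this
      exact (nXY _ (fx1 d h2) this).elim
    · rw [gY c h1, gY d h2] at hcd
      exact fy2 c h1 d h2 hcd
  obtain ⟨π, hπ⟩ := Finset.exists_equiv_extend_of_card_eq (t := (Finset.univ : Finset (Fin l)))
    (by simp) (Finset.subset_univ (Finset.image g (Kc ∪ Xc ∪ Yc))) ginj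
  refine ⟨fun c => F (π c), fun c => hF _, fun i => (hc i).trans ?_, ?_, ?_, ?_⟩
  · apply Finset.card_le_card_of_injOn (fun j => π.symm ⟨j, Finset.mem_univ _⟩)
    · intro j hj
      simpa using hj
    · intro j _ j' _ hjj
      simpa using hjj
  · intro c h
    beta_reduce
    rw [hπ c (by simp [h]), gK c h]
    exact fk1 c h
  · intro c h
    beta_reduce
    rw [hπ c (by simp [h]), gX c h]
    exact fx1 c h
  · intro c h
    beta_reduce
    rw [hπ c (by simp [h]), gY c h]
    exact fy1 c h

/-- The auxiliary vertices whose colour classes serve the refined class `i`; the Boolean tells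
to which half of the shared class a colour belongs. -/
def source (b : Bool) (i : Fin 12) : List (Fin 14) :=
  match i.val with
  | 0 => [0] | 1 => [1] | 2 => [2] | 3 => [3] | 4 => [4] | 5 => [5]
  | 6 => if b then [6] else [6, 10]
  | 7 => if b then [7, 10] else [7]
  | 8 => [8] | 9 => [9]
  | 10 => if b then [10] else []
  | _ => if b then [] else [10]

lemma source_adj : ∀ (b : Bool) (i j : Fin 12), adj12 i j = true → ∀ t ∈ source b i,
    ∀ t' ∈ source b j, auxEdge t t' = true ∨ auxEdge t' t = true := by decide

/-- Colour sets for the refined classes. -/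
lemma palettes {l : ℕ} (n : Fin 12 → ℕ) (k x y : ℕ) (h10 : n 10 ≤ n 7) (h11 : n 11 ≤ n 6)
    (F : Fin l → Finset (Fin 14)) (hF : ∀ j, Stab (F j))
    (hc : ∀ i, demand n k x y i ≤ (Finset.univ.filter fun j => i ∈ F j).card) :
    ∃ D : Fin 12 → Finset (Fin l), (∀ i, n i ≤ (D i).card) ∧
      (∀ i j, adj12 i j = true → Disjoint (D i) (D j)) ∧
      (∀ i : Fin 12, (i = 0 ∨ i = 1) → ∀ c ∈ D i, 11 ∉ F c ∧ 12 ∉ F c) ∧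
      (∀ i : Fin 12, (i = 3 ∨ i = 4) → ∀ c ∈ D i, 11 ∉ F c ∧ 13 ∉ F c) := by
  classical
  let C : Fin 14 → Finset (Fin l) := fun i => Finset.univ.filter fun j => i ∈ F j
  have hC : ∀ i, demand n k x y i ≤ (C i).card := hc
  have c10 : n 10 + n 11 ≤ (C 10).card := hC 10
  obtain ⟨Z1, hZ1, hZc⟩ := Finset.exists_subset_card_eq (show n 10 ≤ (C 10).card by omega)
  have hZ2 : n 11 ≤ (C 10 \ Z1).card := by
    rw [Finset.card_sdiff_of_subset hZ1]
    omega
  let D : Fin 12 → Finset (Fin l) := fun i =>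
    Finset.univ.filter fun c => ∃ t ∈ source (decide (c ∈ Z1)) i, t ∈ F c
  have memD : ∀ i c, c ∈ D i ↔ ∃ t ∈ source (decide (c ∈ Z1)) i, t ∈ F c := by
    intro i c
    simp [D]
  have memC : ∀ i c, c ∈ C i ↔ i ∈ F c := by
    intro i c
    simp [C]
  have sub : ∀ (i : Fin 12) (t : Fin 14), (∀ b, t ∈ source b i) → C t ⊆ D i := by
    intro i t h c hct
    exact (memD i c).2 ⟨t, h _, (memC t c).1 hct⟩
  have simple : ∀ (i : Fin 12) (t : Fin 14), (∀ b, t ∈ source b i) → demand n k x y t = n i →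
      n i ≤ (D i).card := by
    intro i t h h'
    rw [← h']
    exact (hC t).trans (Finset.card_le_card (sub i t h))
  have subZ1 : ∀ i : Fin 12, 10 ∈ source true i → Z1 ⊆ D i := by
    intro i h c hcz
    refine (memD i c).2 ⟨10, ?_, (memC 10 c).1 (hZ1 hcz)⟩
    simpa [hcz] using h
  have subZ2 : ∀ i : Fin 12, 10 ∈ source false i → C 10 \ Z1 ⊆ D i := by
    intro i h c hcz
    obtain ⟨h1, h2⟩ := Finset.mem_sdiff.1 hcz
    refine (memD i c).2 ⟨10, ?_, (memC 10 c).1 h1⟩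
    simpa [h2] using h
  have nst : ∀ c (i j : Fin 14), i ∈ F c → j ∈ F c → auxEdge i j = true → False := by
    intro c i j h1 h2 h
    rw [hF c i h1 j h2] at h
    exact absurd h (by decide)
  refine ⟨D, ?_, ?_, ?_, ?_⟩
  · have k6 : n 6 ≤ (D 6).card := by
      have h1 : C 6 ∪ (C 10 \ Z1) ⊆ D 6 :=
        Finset.union_subset (sub 6 6 (by decide)) (subZ2 6 (by decide))
      have h2 := Finset.card_le_card h1
      rw [Finset.card_union_of_disjoint] at h2
      · have h3 : n 6 - n 11 ≤ (C 6).card := hC 6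
        omega
      · rw [Finset.disjoint_left]
        intro c hc1 hc2
        exact nst c 6 10 ((memC _ _).1 hc1) ((memC _ _).1 (Finset.mem_sdiff.1 hc2).1) (by decide)
    have k7 : n 7 ≤ (D 7).card := by
      have h1 : C 7 ∪ Z1 ⊆ D 7 :=
        Finset.union_subset (sub 7 7 (by decide)) (subZ1 7 (by decide))
      have h2 := Finset.card_le_card h1
      rw [Finset.card_union_of_disjoint] at h2
      · have h3 : n 7 - n 10 ≤ (C 7).card := hC 7
        omega
      · rw [Finset.disjoint_left]
        intro c hc1 hc2
        exact nst c 7 10 ((memC _ _).1 hc1) ((memC _ _).1 (hZ1 hc2)) (by decide)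
    have k10 : n 10 ≤ (D 10).card := by
      rw [← hZc]
      exact Finset.card_le_card (subZ1 10 (by decide))
    have k11 : n 11 ≤ (D 11).card := hZ2.trans (Finset.card_le_card (subZ2 11 (by decide)))
    intro i
    fin_cases i
    · exact simple 0 0 (by decide) rfl
    · exact simple 1 1 (by decide) rfl
    · exact simple 2 2 (by decide) rfl
    · exact simple 3 3 (by decide) rfl
    · exact simple 4 4 (by decide) rfl
    · exact simple 5 5 (by decide) rfl
    · exact k6
    · exact k7
    · exact simple 8 8 (by decide) rfl
    · exact simple 9 9 (by decide) rfl
    · exact k10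
    · exact k11
  · intro i j hij
    rw [Finset.disjoint_left]
    intro c h1 h2
    obtain ⟨t, ht, htF⟩ := (memD _ _).1 h1
    obtain ⟨t', ht', htF'⟩ := (memD _ _).1 h2
    rcases source_adj _ i j hij t ht t' ht' with h | h
    · exact nst c _ _ htF htF' h
    · exact nst c _ _ htF' htF h
  · intro i hi c hcD
    obtain ⟨t, ht, htF⟩ := (memD _ _).1 hcD
    have d : ∀ (b : Bool) (i : Fin 12), (i = 0 ∨ i = 1) → ∀ t ∈ source b i,
      auxEdge t 11 = true ∧ auxEdge t 12 = true := by decide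
    have := d _ i hi t ht
    exact ⟨fun h => nst c _ _ htF h this.1, fun h => nst c _ _ htF h this.2⟩
  · intro i hi c hcD
    obtain ⟨t, ht, htF⟩ := (memD _ _).1 hcD
    have d : ∀ (b : Bool) (i : Fin 12), (i = 3 ∨ i = 4) → ∀ t ∈ source b i,
      auxEdge t 11 = true ∧ auxEdge t 13 = true := by decide
    have := d _ i hi t ht
    exact ⟨fun h => nst c _ _ htF h this.1, fun h => nst c _ _ htF h this.2⟩

theorem stmt17 {V : Type*} [Fintype V] [DecidableEq V] (G : SimpleGraph V)
    (V1 V2 X1 Y1 X2 Y2 : Finset V)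
    (hsk : Skeletal G) (hcf : ClawFree G)
    (hj : IsGen2Join G V1 V2 X1 Y1 X2 Y2)
    (hstrip : IsGearStripOn G V2 X2 Y2)
    (l : ℕ) (hl : gammaLJ G V2 X1 Y1 ≤ l)
    (hcol : (G.induce (↑V1 : Set V)).Colorable l) :
    G.Colorable l := by
  classical
  obtain ⟨cls, hc⟩ := exists_gearCls G V1 V2 X1 Y1 X2 Y2 hsk hj hstrip
  have hpos : 0 < l := by
    obtain ⟨v, hv, -⟩ := hc.ne 0 (by decide)
    have := extract G V2 X1 Y1 l hl v hv ∅ {v} (by simp) (by simp) (by simp)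
      (by
        intro w hw
        rw [Finset.mem_singleton.1 hw]
        exact Finset.mem_union_left _ (Finset.mem_union_left _ hv))
      (by
        rintro ⟨⟨x, hx, hx1, -⟩, -⟩
        rw [Finset.mem_singleton.1 hx] at hx1
        exact Finset.disjoint_left.1 hj.disjV (hj.subX1 hx1) hv)
    simp at this
    omega
  haveI : Inhabited (Fin l) := ⟨⟨0, hpos⟩⟩
  obtain ⟨c0⟩ := hcol
  let d : V → Fin l := fun v => if h : v ∈ V1 then c0 ⟨v, h⟩ else default
  have hd : ∀ u ∈ V1, ∀ v ∈ V1, G.Adj u v → d u ≠ d v := by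
    intro u hu v hv huv
    simp only [d, hu, hv, dite_true]
    exact c0.valid (v := ⟨u, hu⟩) (w := ⟨v, hv⟩) huv
  let P := X1.image d
  let R := Y1.image d
  have hP : P.card = X1.card := by
    apply Finset.card_image_of_injOn
    intro u hu v hv huv
    by_contra hne
    exact hd u (hj.subX1 hu) v (hj.subX1 hv) (hj.cliqueX (Or.inl hu) (Or.inl hv) hne) huv
  have hR : R.card = Y1.card := by
    apply Finset.card_image_of_injOn
    intro u hu v hv huv
    by_contra hne
    exact hd u (hj.subY1 hu) v (hj.subY1 hv) (hj.cliqueY (Or.inl hu) (Or.inl hv) hne) huv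
  have e1 : X1.card = (P ∩ R).card + (P \ R).card := by
    rw [← hP, ← Finset.card_sdiff_add_card_inter P R, add_comm]
  have e2 : Y1.card = (P ∩ R).card + (R \ P).card := by
    rw [← hR, ← Finset.card_sdiff_add_card_inter R P, add_comm, Finset.inter_comm]
  have dKX : Disjoint (P ∩ R) (P \ R) := by
    rw [Finset.disjoint_left]
    intro c h1 h2
    exact (Finset.mem_sdiff.1 h2).2 (Finset.mem_inter.1 h1).2
  have dKY : Disjoint (P ∩ R) (R \ P) := by
    rw [Finset.disjoint_left]
    intro c h1 h2
    exact (Finset.mem_sdiff.1 h2).2 (Finset.mem_inter.1 h1).1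
  have dXY : Disjoint (P \ R) (R \ P) := by
    rw [Finset.disjoint_left]
    intro c h1 h2
    exact (Finset.mem_sdiff.1 h2).2 (Finset.mem_sdiff.1 h1).1
  have htot : (P ∩ R).card + (P \ R).card + (R \ P).card ≤ l := by
    rw [← Finset.card_union_of_disjoint dKX, ← Finset.card_union_of_disjoint]
    · exact (Finset.card_le_univ _).trans (by simp)
    · exact Finset.disjoint_union_left.2 ⟨dKY, dXY⟩
  have hcon := con_of_gear G V1 V2 X1 Y1 X2 Y2 hj cls hc l hl _ _ _ e1 e2 htot
  obtain ⟨F, hF, hcnt, hFK, hFX, hFY⟩ := reindex_sets (core l _ hcon) (P ∩ R) (P \ R) (R \ P)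
    dKX dKY dXY rfl rfl rfl
  obtain ⟨D, hDc, hDd, hDX, hDY⟩ := palettes (clsCard V2 cls) _ _ _ hc.h10 hc.h11 F hF hcnt
  have hφ : ∀ i : Fin 12, ∃ f : V → Fin l, (∀ a ∈ V2.filter fun v => cls v = i, f a ∈ D i) ∧
      ∀ a ∈ V2.filter fun v => cls v = i, ∀ b ∈ V2.filter fun v => cls v = i,
        f a = f b → a = b := fun i => exists_inj _ _ (hDc i)
  choose φ hφ1 hφ2 using hφ
  let e : V → Fin l := fun v => if v ∈ V1 then d v else φ (cls v) v
  have eV1 : ∀ v ∈ V1, e v = d v := fun v hv => if_pos hv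
  have eV2 : ∀ v ∈ V2, e v = φ (cls v) v := fun v hv =>
    if_neg fun h => Finset.disjoint_left.1 hj.disjV h hv
  have eD : ∀ v ∈ V2, e v ∈ D (cls v) := by
    intro v hv
    rw [eV2 v hv]
    exact hφ1 _ v (Finset.mem_filter.2 ⟨hv, rfl⟩)
  have cross : ∀ u ∈ V1, ∀ v ∈ V2, G.Adj u v → e u ≠ e v := by
    intro u hu v hv huv heq
    have hD := eD v hv
    rw [← heq, eV1 u hu] at hD
    rcases hj.cross u hu v hv huv with ⟨h1, h2⟩ | ⟨h1, h2⟩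
    · have h3 := hDX _ ((hc.hX v hv).1 h2) _ hD
      have h4 : d u ∈ P := Finset.mem_image_of_mem d h1
      by_cases h5 : d u ∈ R
      · exact h3.1 (hFK _ (Finset.mem_inter.2 ⟨h4, h5⟩))
      · exact h3.2 (hFX _ (Finset.mem_sdiff.2 ⟨h4, h5⟩))
    · have h3 := hDY _ ((hc.hY v hv).1 h2) _ hD
      have h4 : d u ∈ R := Finset.mem_image_of_mem d h1
      by_cases h5 : d u ∈ P
      · exact h3.1 (hFK _ (Finset.mem_inter.2 ⟨h5, h4⟩))
      · exact h3.2 (hFY _ (Finset.mem_sdiff.2 ⟨h4, h5⟩))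
  have hV : ∀ v, v ∈ V1 ∨ v ∈ V2 := by
    intro v
    have : v ∈ V1 ∪ V2 := by rw [hj.unionV]; exact Finset.mem_univ _
    exact Finset.mem_union.1 this
  refine ⟨SimpleGraph.Coloring.mk e ?_⟩
  intro u v huv
  rcases hV u with hu | hu <;> rcases hV v with hv | hv
  · rw [eV1 u hu, eV1 v hv]
    exact hd u hu v hv huv
  · exact cross u hu v hv huv
  · exact (cross v hv u hu huv.symm).symm
  · rcases (hc.adj u hu v hv huv.ne).1 huv with h | h
    · rw [eV2 u hu, eV2 v hv, h]
      intro heq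
      exact huv.ne (hφ2 (cls v) u (Finset.mem_filter.2 ⟨hu, h⟩) v
        (Finset.mem_filter.2 ⟨hv, rfl⟩) heq)
    · intro heq
      have h1 := eD u hu
      rw [heq] at h1
      exact Finset.disjoint_left.1 (hDd _ _ h) h1 (eD v hv)

end Paper
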